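/- For every Young diagram λ, the normalized character on a 6-cycle satisfies Σ_6^λ = R_7^λ + 35·R_5^λ + 35·R_3^λ·R_2^λ + 84·R_3^λ (i.e., the Kerov polynomial K_6 equals R_7 + 35R_5 + 35R_3R_2 + 84R_3). -/

import Mathlib

open scoped BigOperators

namespace AsympRep

/-- A fixed filling: the canonical bijection between `Fin μ.card` and the cells of `μ`. -/
noncomputable def fill (μ : YoungDiagram) : Fin μ.card ≃ {c // c ∈ μ.cells} :=
  (Fintype.equivFinOfCardEq (Fintype.card_coe _)).symm

/-- Row coordinate of the box occupied by `x` in the canonical filling. -/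
noncomputable def rowOf (μ : YoungDiagram) (x : Fin μ.card) : ℕ := (fill μ x).1.1

/-- Column coordinate of the box occupied by `x` in the canonical filling. -/
noncomputable def colOf (μ : YoungDiagram) (x : Fin μ.card) : ℕ := (fill μ x).1.2

/-- The Young symmetrizer `c_μ = a_μ * b_μ` in the group algebra `ℚ[S_n]`, `n = |μ|`,
where `a_μ` is the sum of the row-preserving permutations and `b_μ` is the signed sum
of the column-preserving permutations (for the canonical filling of `μ`). -/
noncomputable def youngSymmetrizer (μ : YoungDiagram) :
    MonoidAlgebra ℚ (Equiv.Perm (Fin μ.card)) :=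
  (∑ g : Equiv.Perm (Fin μ.card),
      if ∀ x, rowOf μ (g x) = rowOf μ x then MonoidAlgebra.single g (1 : ℚ) else 0) *
  (∑ g : Equiv.Perm (Fin μ.card),
      if ∀ x, colOf μ (g x) = colOf μ x
      then MonoidAlgebra.single g ((Equiv.Perm.sign g : ℤ) : ℚ) else 0)

/-- The Specht module: the left ideal `ℚ[S_n]·c_μ`, realizing the irreducible
representation `ρ^μ` of `S_n` (by left multiplication). -/
noncomputable def spechtModule (μ : YoungDiagram) :
    Submodule ℚ (MonoidAlgebra ℚ (Equiv.Perm (Fin μ.card))) :=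
  LinearMap.range (LinearMap.mulRight ℚ (youngSymmetrizer μ))

theorem spechtModule_invariant (μ : YoungDiagram) (π : Equiv.Perm (Fin μ.card)) :
    ∀ x ∈ spechtModule μ,
      (LinearMap.mulLeft ℚ (MonoidAlgebra.single π (1 : ℚ))) x ∈ spechtModule μ := by
  rintro x ⟨y, rfl⟩
  exact ⟨MonoidAlgebra.single π (1 : ℚ) * y, by
    simp only [LinearMap.mulRight_apply, LinearMap.mulLeft_apply, mul_assoc]⟩

/-- The irreducible character `χ^μ(π) = Tr ρ^μ(π)` of the symmetric group `S_n`,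
`n = |μ|`, computed as the trace of left multiplication by `π` on the Specht module. -/
noncomputable def irrChar (μ : YoungDiagram) (π : Equiv.Perm (Fin μ.card)) : ℚ :=
  LinearMap.trace ℚ (spechtModule μ)
    ((LinearMap.mulLeft ℚ (MonoidAlgebra.single π (1 : ℚ))).restrict
      (spechtModule_invariant μ π))

/-- The normalized character
`Σ_π^μ = n(n-1)⋯(n-k+1) · Tr ρ^μ(π) / Tr ρ^μ(e)` for `π ∈ S_k`, where `π` is regarded
as a permutation of `{1,…,n}` acting as the identity on `{k+1,…,n}`; it is `0` if `k > n`. -/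
noncomputable def normChar {k : ℕ} (μ : YoungDiagram) (π : Equiv.Perm (Fin k)) : ℚ :=
  if h : k ≤ μ.card then
    (μ.card.descFactorial k : ℚ)
      * irrChar μ (π.viaEmbedding (Fin.castLEEmb h)) / irrChar μ 1
  else 0

/-- `Σ_m^μ`: the normalized character on the `m`-cycle `(1,2,…,m) ∈ S_m`. -/
noncomputable def SigmaCycle (μ : YoungDiagram) (m : ℕ) : ℚ := normChar μ (finRotate m)

/-- The dilation `sμ` of a Young diagram: every box is replaced by an `s × s` grid
of boxes. -/
def dilate (μ : YoungDiagram) (s : ℕ) : YoungDiagram where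
  cells := (Finset.range (s * μ.colLen 0) ×ˢ Finset.range (s * μ.rowLen 0)).filter
      (fun c => (c.1 / s, c.2 / s) ∈ μ.cells)
  isLowerSet := by
    intro a b hba h
    simp only [Finset.coe_filter, Set.mem_setOf_eq, Finset.mem_product,
      Finset.mem_range] at h ⊢
    exact ⟨⟨lt_of_le_of_lt hba.1 h.1.1, lt_of_le_of_lt hba.2 h.1.2⟩,
      μ.isLowerSet (Prod.mk_le_mk.mpr
        ⟨Nat.div_le_div_right hba.1, Nat.div_le_div_right hba.2⟩) h.2⟩

open scoped Classical in
/-- The `k`-th free cumulant `R_k^μ`: the coefficient of `s^k` in the polynomial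
`s ↦ Σ_{k-1}^{sμ}`. -/
noncomputable def freeCumulant (μ : YoungDiagram) (k : ℕ) : ℚ :=
  if h : ∃ p : Polynomial ℚ, ∀ s : ℕ, 0 < s →
      SigmaCycle (dilate μ s) (k - 1) = Polynomial.eval (s : ℚ) p
  then h.choose.coeff k else 0

/-- `N^μ(σ₁,σ₂)`: the number of colorings of the cycles of `σ₁` (by column numbers)
and of the cycles of `σ₂` (by row numbers) compatible with `μ`.  A coloring of the
cycles is encoded as a pair of functions on points constant on the respective cycles;
compatibility means that for every point `a` the box in column `h₁(a)` and row `h₂(a)`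
belongs to `μ` (two cycles intersect precisely when they share a point). -/
noncomputable def Ncolorings {k : ℕ} (μ : YoungDiagram) (σ₁ σ₂ : Equiv.Perm (Fin k)) : ℕ :=
  Set.ncard {h : (Fin k → ℕ) × (Fin k → ℕ) |
    (∀ a, h.1 (σ₁ a) = h.1 a) ∧ (∀ a, h.2 (σ₂ a) = h.2 a) ∧
    ∀ a, (h.2 a, h.1 a) ∈ μ.cells }

/-- `|C(σ)|`: the number of cycles of a permutation (fixed points count as cycles),
i.e. the number of orbits. -/
noncomputable def numCycles {k : ℕ} (σ : Equiv.Perm (Fin k)) : ℕ :=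
  Set.ncard {s : Set (Fin k) | ∃ a, s = {b | σ.SameCycle a b}}

/-- The region of the plane occupied by the Young diagram `μ` drawn in the French
convention (row `i` of the diagram, `0`-indexed, occupies `[0, μ_i] × [i, i+1]`). -/
def frenchRegion (μ : YoungDiagram) : Set (ℝ × ℝ) :=
  {p | 0 ≤ p.1 ∧ 0 ≤ p.2 ∧ p.1 ≤ (μ.rowLen ⌊p.2⌋.toNat : ℝ)}

/-- The parameter `S_i^μ = (i-1) ∬_{(x,y)∈μ} (x-y)^{i-2} dx dy` (French convention). -/
noncomputable def Sparam (μ : YoungDiagram) (i : ℕ) : ℝ :=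
  ((i : ℝ) - 1) * ∫ p in frenchRegion μ, (p.1 - p.2) ^ (i - 2)

/-- The profile `ω : ℝ → ℝ` of a Young diagram: the boundary of the diagram drawn in
the Russian convention, i.e. the image of the French region under the rotation by `π/4`
composed with the dilation by `√2`, `(x, y) ↦ (x - y, x + y)`.  `ω(u)` is the largest
`v` with `(u,v)` in the rotated region, and `ω(u) = |u|` away from the diagram. -/
noncomputable def profile (μ : YoungDiagram) (u : ℝ) : ℝ :=
  max |u| (sSup {v : ℝ | ((u + v) / 2, (v - u) / 2) ∈ frenchRegion μ})

section

open Equiv (Perm)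

theorem rowOf_colOf_mem (μ : YoungDiagram) (x : Fin μ.card) :
    (rowOf μ x, colOf μ x) ∈ μ.cells := (fill μ x).2

theorem eq_of_rowOf_eq_of_colOf_eq {μ : YoungDiagram} {x y : Fin μ.card}
    (hr : rowOf μ x = rowOf μ y) (hc : colOf μ x = colOf μ y) : x = y :=
  (fill μ).injective (Subtype.ext (Prod.ext hr hc))

theorem exists_rowOf_colOf {μ : YoungDiagram} {i j : ℕ} (h : (i, j) ∈ μ.cells) :
    ∃ x, rowOf μ x = i ∧ colOf μ x = j :=
  ⟨(fill μ).symm ⟨(i, j), h⟩, by simp [rowOf, colOf]⟩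

theorem card_rowOf_eq_colOf_lt (μ : YoungDiagram) (i k : ℕ) :
    (Finset.univ.filter fun x => rowOf μ x = i ∧ colOf μ x < k).card = min (μ.rowLen i) k := by
  rw [← Finset.card_range (min (μ.rowLen i) k)]
  refine Finset.card_bij (fun x _ => colOf μ x) ?_ ?_ ?_
  · intro x hx
    simp only [Finset.mem_filter, Finset.mem_univ, true_and] at hx
    have := rowOf_colOf_mem μ x
    rw [YoungDiagram.mem_cells, YoungDiagram.mem_iff_lt_rowLen, hx.1] at this
    simp [this, hx.2]
  · intro x hx y hy h
    simp only [Finset.mem_filter, Finset.mem_univ, true_and] at hx hy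
    exact eq_of_rowOf_eq_of_colOf_eq (hx.1.trans hy.1.symm) h
  · intro j hj
    simp only [Finset.mem_range, lt_min_iff] at hj
    obtain ⟨x, hx, hx'⟩ := exists_rowOf_colOf (μ := μ) (i := i) (j := j)
      (by rw [YoungDiagram.mem_cells, YoungDiagram.mem_iff_lt_rowLen]; exact hj.1)
    exact ⟨x, by simp [hx, hx', hj.2], hx'⟩

/-- If `g` sends distinct boxes of a row to distinct columns, then moving every box within its
row to the column of its image stays inside the diagram. -/
theorem rowOf_colOf_perm_mem {μ : YoungDiagram} {g : Perm (Fin μ.card)}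
    (hg : ∀ x y, rowOf μ x = rowOf μ y → colOf μ (g x) = colOf μ (g y) → x = y)
    (x : Fin μ.card) : (rowOf μ x, colOf μ (g x)) ∈ μ.cells := by
  classical
  set k := μ.rowLen (rowOf μ x) with hk
  have hle : ∀ i, (Finset.univ.filter fun y => rowOf μ y = i ∧ colOf μ (g y) < k).card ≤
      (Finset.univ.filter fun y => rowOf μ y = i ∧ colOf μ y < k).card := by
    intro i
    rw [card_rowOf_eq_colOf_lt, le_min_iff]
    constructor
    · have h := card_rowOf_eq_colOf_lt μ i (μ.rowLen i)
      rw [min_self] at h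
      rw [← h]
      refine Finset.card_le_card fun y hy => ?_
      simp only [Finset.mem_filter, Finset.mem_univ, true_and] at hy ⊢
      refine ⟨hy.1, ?_⟩
      have := rowOf_colOf_mem μ y
      rwa [YoungDiagram.mem_cells, YoungDiagram.mem_iff_lt_rowLen, hy.1] at this
    · conv_rhs => rw [← Finset.card_range k]
      refine Finset.card_le_card_of_injOn (fun y => colOf μ (g y)) ?_ ?_
      · intro y hy
        simp only [Finset.coe_filter, Finset.mem_univ, true_and, Set.mem_ofPred_eq] at hy
        simpa using hy.2
      · intro y hy z hz h
        simp only [Finset.coe_filter, Finset.mem_univ, true_and, Set.mem_ofPred_eq] at hy hz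
        exact hg y z (hy.1.trans hz.1.symm) h
  have hsum : ∀ f : Fin μ.card → ℕ, (Finset.univ.filter fun y => f y < k).card =
      ∑ i ∈ Finset.univ.image (rowOf μ),
        (Finset.univ.filter fun y => rowOf μ y = i ∧ f y < k).card := by
    intro f
    rw [Finset.card_eq_sum_card_fiberwise (f := rowOf μ) (t := Finset.univ.image (rowOf μ))]
    · refine Finset.sum_congr rfl fun i _ => ?_
      rw [Finset.filter_filter]
      simp only [and_comm]
    · intro y _
      simp
  have htot : (Finset.univ.filter fun y => colOf μ (g y) < k).card =
      (Finset.univ.filter fun y => colOf μ y < k).card := by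
    refine Finset.card_bij (fun y _ => g y) ?_ ?_ ?_
    · intro y hy; simpa using hy
    · intro y _ z _ h; exact g.injective h
    · intro y hy
      exact ⟨g.symm y, by simpa using hy, by simp⟩
  rw [hsum, hsum] at htot
  have heq := (Finset.sum_eq_sum_iff_of_le (fun i _ => hle i)).1 htot (rowOf μ x) (by simp)
  rw [card_rowOf_eq_colOf_lt, ← hk, min_self] at heq
  have hrow := card_rowOf_eq_colOf_lt μ (rowOf μ x) k
  rw [← hk, min_self] at hrow
  have hsub : (Finset.univ.filter fun y => rowOf μ y = rowOf μ x ∧ colOf μ (g y) < k) ⊆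
      (Finset.univ.filter fun y => rowOf μ y = rowOf μ x ∧ colOf μ y < k) := by
    intro y hy
    simp only [Finset.mem_filter, Finset.mem_univ, true_and] at hy ⊢
    refine ⟨hy.1, ?_⟩
    have := rowOf_colOf_mem μ y
    rwa [YoungDiagram.mem_cells, YoungDiagram.mem_iff_lt_rowLen, hy.1] at this
  have hset := Finset.eq_of_subset_of_card_le hsub (hrow.trans heq.symm).le
  have hx : x ∈ (Finset.univ.filter fun y => rowOf μ y = rowOf μ x ∧ colOf μ y < k) := by
    have := rowOf_colOf_mem μ x
    rw [YoungDiagram.mem_cells, YoungDiagram.mem_iff_lt_rowLen] at this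
    simpa using this
  rw [← hset] at hx
  rw [YoungDiagram.mem_cells, YoungDiagram.mem_iff_lt_rowLen]
  simpa using hx

/-- The permutation preserves every row of the canonical filling. -/
def IsRowPerm (μ : YoungDiagram) (g : Perm (Fin μ.card)) : Prop :=
  ∀ x, rowOf μ (g x) = rowOf μ x

/-- The permutation preserves every column of the canonical filling. -/
def IsColPerm (μ : YoungDiagram) (g : Perm (Fin μ.card)) : Prop :=
  ∀ x, colOf μ (g x) = colOf μ x

noncomputable instance (μ : YoungDiagram) : DecidablePred (IsRowPerm μ) :=
  fun g => inferInstanceAs (Decidable (∀ x, rowOf μ (g x) = rowOf μ x))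

noncomputable instance (μ : YoungDiagram) : DecidablePred (IsColPerm μ) :=
  fun g => inferInstanceAs (Decidable (∀ x, colOf μ (g x) = colOf μ x))

theorem exists_rowPerm_mul_colPerm_or_exists_collision (μ : YoungDiagram)
    (g : Perm (Fin μ.card)) :
    (∃ p q, IsRowPerm μ p ∧ IsColPerm μ q ∧ g = p * q) ∨
      ∃ x y, x ≠ y ∧ rowOf μ x = rowOf μ y ∧ colOf μ (g⁻¹ x) = colOf μ (g⁻¹ y) := by
  by_cases h : ∃ x y, x ≠ y ∧ rowOf μ x = rowOf μ y ∧ colOf μ (g⁻¹ x) = colOf μ (g⁻¹ y)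
  · exact Or.inr h
  · have hg : ∀ x y, rowOf μ x = rowOf μ y → colOf μ (g⁻¹ x) = colOf μ (g⁻¹ y) → x = y := by
      intro x y hr hc
      by_contra hxy
      exact h ⟨x, y, hxy, hr, hc⟩
    choose f hf hf' using fun x => exists_rowOf_colOf (rowOf_colOf_perm_mem hg x)
    have hinj : Function.Injective f := by
      intro x y hxy
      exact hg x y (by rw [← hf x, ← hf y, hxy]) (by rw [← hf' x, ← hf' y, hxy])
    let p : Perm (Fin μ.card) := Equiv.ofBijective f (Finite.injective_iff_bijective.1 hinj)
    have hp : ∀ x, p x = f x := fun x => rfl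
    refine Or.inl ⟨p⁻¹, p * g, fun x => ?_, fun x => ?_, by group⟩
    · have := hf (p⁻¹ x)
      rw [← hp] at this
      simpa using this.symm
    · simp [hp, hf']

/-- The sum of the row-preserving permutations. -/
noncomputable def rowSum (μ : YoungDiagram) : MonoidAlgebra ℚ (Perm (Fin μ.card)) :=
  ∑ g : Perm (Fin μ.card), if IsRowPerm μ g then MonoidAlgebra.single g (1 : ℚ) else 0

/-- The signed sum of the column-preserving permutations. -/
noncomputable def colSum (μ : YoungDiagram) : MonoidAlgebra ℚ (Perm (Fin μ.card)) :=
  ∑ g : Perm (Fin μ.card),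
    if IsColPerm μ g then MonoidAlgebra.single g ((Perm.sign g : ℤ) : ℚ) else 0

theorem youngSymmetrizer_eq (μ : YoungDiagram) : youngSymmetrizer μ = rowSum μ * colSum μ := rfl

theorem IsRowPerm.mul {μ : YoungDiagram} {p q : Perm (Fin μ.card)} (hp : IsRowPerm μ p)
    (hq : IsRowPerm μ q) : IsRowPerm μ (p * q) := fun x => (hp _).trans (hq x)

theorem IsColPerm.mul {μ : YoungDiagram} {p q : Perm (Fin μ.card)} (hp : IsColPerm μ p)
    (hq : IsColPerm μ q) : IsColPerm μ (p * q) := fun x => (hp _).trans (hq x)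

theorem IsRowPerm.inv {μ : YoungDiagram} {p : Perm (Fin μ.card)} (hp : IsRowPerm μ p) :
    IsRowPerm μ p⁻¹ := fun x => by simpa using (hp (p⁻¹ x)).symm

theorem IsColPerm.inv {μ : YoungDiagram} {p : Perm (Fin μ.card)} (hp : IsColPerm μ p) :
    IsColPerm μ p⁻¹ := fun x => by simpa using (hp (p⁻¹ x)).symm

theorem rowSum_mul_single {μ : YoungDiagram} {p : Perm (Fin μ.card)} (hp : IsRowPerm μ p) :
    rowSum μ * MonoidAlgebra.single p 1 = rowSum μ := by
  rw [rowSum, Finset.sum_mul]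
  refine Fintype.sum_equiv (Equiv.mulRight p) _ _ fun g => ?_
  have : IsRowPerm μ (g * p) ↔ IsRowPerm μ g :=
    ⟨fun h => by simpa using h.mul hp.inv, fun h => h.mul hp⟩
  simp only [Equiv.coe_mulRight, this, ite_mul, MonoidAlgebra.single_mul_single, zero_mul, mul_one]

theorem single_mul_colSum {μ : YoungDiagram} {q : Perm (Fin μ.card)} (hq : IsColPerm μ q) :
    MonoidAlgebra.single q 1 * colSum μ = ((Perm.sign q : ℤ) : ℚ) • colSum μ := by
  rw [colSum, Finset.mul_sum, Finset.smul_sum]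
  refine Fintype.sum_equiv (Equiv.mulLeft q) _ _ fun g => ?_
  have : IsColPerm μ (q * g) ↔ IsColPerm μ g :=
    ⟨fun h => by simpa using hq.inv.mul h, fun h => hq.mul h⟩
  simp only [Equiv.coe_mulLeft, this, mul_ite, MonoidAlgebra.single_mul_single, mul_zero, one_mul,
    smul_ite, smul_zero, MonoidAlgebra.smul_single, Perm.sign_mul, Units.val_mul, Int.cast_mul,
    smul_eq_mul, ← mul_assoc]
  rw [← Int.cast_mul, Int.units_coe_mul_self]
  simp

theorem rowSum_mul_single_mul_colSum (μ : YoungDiagram) (g : Perm (Fin μ.card)) :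
    ∃ κ : ℚ, rowSum μ * MonoidAlgebra.single g 1 * colSum μ = κ • youngSymmetrizer μ := by
  rcases exists_rowPerm_mul_colPerm_or_exists_collision μ g with
    ⟨p, q, hp, hq, rfl⟩ | ⟨x, y, hxy, hr, hc⟩
  · refine ⟨((Perm.sign q : ℤ) : ℚ), ?_⟩
    have : MonoidAlgebra.single (p * q) (1 : ℚ) =
        MonoidAlgebra.single p 1 * MonoidAlgebra.single q 1 := by
      rw [MonoidAlgebra.single_mul_single, one_mul]
    rw [this, ← mul_assoc, rowSum_mul_single hp, mul_assoc, single_mul_colSum hq,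
      youngSymmetrizer_eq, mul_smul_comm]
  · refine ⟨0, ?_⟩
    have ht : IsRowPerm μ (Equiv.swap x y) := by
      intro z
      by_cases hzx : z = x
      · subst hzx; rw [Equiv.swap_apply_left, hr]
      · by_cases hzy : z = y
        · subst hzy; rw [Equiv.swap_apply_right, hr]
        · rw [Equiv.swap_apply_of_ne_of_ne hzx hzy]
    have hs : IsColPerm μ (Equiv.swap (g⁻¹ x) (g⁻¹ y)) := by
      intro z
      by_cases hzx : z = g⁻¹ x
      · subst hzx; rw [Equiv.swap_apply_left, hc]
      · by_cases hzy : z = g⁻¹ y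
        · subst hzy; rw [Equiv.swap_apply_right, hc]
        · rw [Equiv.swap_apply_of_ne_of_ne hzx hzy]
    have hconj : Equiv.swap x y * g = g * Equiv.swap (g⁻¹ x) (g⁻¹ y) := by
      rw [Equiv.mul_swap_eq_swap_mul]
      simp
    have hneg : rowSum μ * MonoidAlgebra.single g 1 * colSum μ =
        -(rowSum μ * MonoidAlgebra.single g 1 * colSum μ) := by
      conv_lhs => rw [← rowSum_mul_single ht, mul_assoc (rowSum μ),
        MonoidAlgebra.single_mul_single, hconj, ← MonoidAlgebra.single_mul_single, ← mul_assoc,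
        mul_assoc, single_mul_colSum hs]
      rw [Perm.sign_swap (by simpa using hxy)]
      simp
    rw [zero_smul]
    have h2 : (2 : ℚ) • (rowSum μ * MonoidAlgebra.single g 1 * colSum μ) = 0 := by
      rw [two_smul]
      nth_rewrite 1 [hneg]
      exact neg_add_cancel _
    exact (smul_eq_zero.1 h2).resolve_left two_ne_zero

theorem exists_rowSum_mul_mul_colSum (μ : YoungDiagram)
    (x : MonoidAlgebra ℚ (Perm (Fin μ.card))) :
    ∃ κ : ℚ, rowSum μ * x * colSum μ = κ • youngSymmetrizer μ := by
  induction x using MonoidAlgebra.induction_linear with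
  | zero => exact ⟨0, by simp⟩
  | add x y hx hy =>
    obtain ⟨a, ha⟩ := hx
    obtain ⟨b, hb⟩ := hy
    exact ⟨a + b, by rw [mul_add, add_mul, ha, hb, add_smul]⟩
  | single g r =>
    obtain ⟨a, ha⟩ := rowSum_mul_single_mul_colSum μ g
    refine ⟨r * a, ?_⟩
    have : MonoidAlgebra.single g r = r • MonoidAlgebra.single g (1 : ℚ) := by
      rw [MonoidAlgebra.smul_single', mul_one]
    rw [this, mul_smul_comm, smul_mul_assoc, ha, smul_smul]

theorem exists_youngSymmetrizer_mul_self (μ : YoungDiagram) :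
    ∃ κ : ℚ, youngSymmetrizer μ * youngSymmetrizer μ = κ • youngSymmetrizer μ := by
  obtain ⟨κ, h⟩ := exists_rowSum_mul_mul_colSum μ (colSum μ * rowSum μ)
  exact ⟨κ, by rw [← h, youngSymmetrizer_eq]; simp only [mul_assoc]⟩

theorem coeff_youngSymmetrizer (μ : YoungDiagram) (h : Perm (Fin μ.card)) :
    (youngSymmetrizer μ).coeff h = ∑ p : Perm (Fin μ.card), ∑ q : Perm (Fin μ.card),
      if IsRowPerm μ p ∧ IsColPerm μ q ∧ p * q = h then ((Perm.sign q : ℤ) : ℚ) else 0 := by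
  rw [youngSymmetrizer_eq, rowSum, colSum, Finset.sum_mul_sum]
  simp only [MonoidAlgebra.coeff_sum, Finsupp.finsetSum_apply]
  refine Finset.sum_congr rfl fun p _ => Finset.sum_congr rfl fun q _ => ?_
  by_cases hp : IsRowPerm μ p <;> by_cases hq : IsColPerm μ q <;>
    simp [hp, hq, MonoidAlgebra.single_mul_single, Finsupp.single_apply]

theorem eq_of_isRowPerm_mul_isColPerm {μ : YoungDiagram} {p q : Perm (Fin μ.card)}
    (hp : IsRowPerm μ p) (hq : IsColPerm μ q) {x : Fin μ.card} (h : (p * q) x = x) :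
    p x = x ∧ q x = x := by
  have hq' : q x = x := by
    have h1 : rowOf μ (q x) = rowOf μ x := by
      rw [← hp (q x)]; exact congrArg (rowOf μ) h
    exact eq_of_rowOf_eq_of_colOf_eq h1 (hq x)
  refine ⟨?_, hq'⟩
  rw [Perm.mul_apply, hq'] at h
  exact h

theorem coeff_youngSymmetrizer_one (μ : YoungDiagram) : (youngSymmetrizer μ).coeff 1 = 1 := by
  rw [coeff_youngSymmetrizer, Finset.sum_eq_single 1, Finset.sum_eq_single 1]
  · simp [IsRowPerm, IsColPerm]
  · intro q _ hq
    rw [if_neg]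
    rintro ⟨-, -, h⟩
    exact hq (by simpa using h)
  · simp
  · intro p _ hp
    refine Finset.sum_eq_zero fun q _ => if_neg ?_
    rintro ⟨hp', hq', h⟩
    exact hp (Equiv.ext fun x => (eq_of_isRowPerm_mul_isColPerm hp' hq' (x := x) (by simp [h])).1)
  · simp

theorem trace_mulLeft_mulRight {G : Type*} [Group G] [Fintype G] (π : G)
    (c : MonoidAlgebra ℚ G) :
    LinearMap.trace ℚ _ (LinearMap.mulLeft ℚ (MonoidAlgebra.single π (1 : ℚ)) ∘ₗ
      LinearMap.mulRight ℚ c) = ∑ g : G, c.coeff (g⁻¹ * π⁻¹ * g) := by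
  classical
  rw [LinearMap.trace_eq_matrix_trace ℚ (MonoidAlgebra.basis G ℚ), Matrix.trace]
  refine Finset.sum_congr rfl fun g _ => ?_
  rw [Matrix.diag_apply, LinearMap.toMatrix_apply]
  simp only [MonoidAlgebra.basis_apply, LinearMap.comp_apply, LinearMap.mulLeft_apply,
    LinearMap.mulRight_apply]
  change (MonoidAlgebra.single π 1 * (MonoidAlgebra.single g 1 * c)).coeff g = _
  rw [MonoidAlgebra.coeff_single_mul_apply, MonoidAlgebra.coeff_single_mul_apply]
  simp [mul_assoc]

theorem irrChar_div_irrChar_one (μ : YoungDiagram) (π : Perm (Fin μ.card)) :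
    irrChar μ π / irrChar μ 1 =
      (∑ g : Perm (Fin μ.card), (youngSymmetrizer μ).coeff (g⁻¹ * π⁻¹ * g)) /
        (μ.card.factorial : ℚ) := by
  obtain ⟨κ, hκ⟩ := exists_youngSymmetrizer_mul_self μ
  have key : ∀ π : Perm (Fin μ.card), κ * irrChar μ π =
      ∑ g : Perm (Fin μ.card), (youngSymmetrizer μ).coeff (g⁻¹ * π⁻¹ * g) := by
    intro π
    rw [← trace_mulLeft_mulRight]
    have h1 : ∀ x, (LinearMap.mulLeft ℚ (MonoidAlgebra.single π (1 : ℚ)) ∘ₗ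
        LinearMap.mulRight ℚ (youngSymmetrizer μ)) x ∈ spechtModule μ := fun x =>
      spechtModule_invariant μ π _ ⟨x, rfl⟩
    rw [← LinearMap.trace_restrict_eq_of_forall_mem _ _ h1 (fun x _ => h1 x), irrChar,
      ← smul_eq_mul, ← map_smul]
    congr 1
    ext ⟨x, y, rfl⟩
    simp [LinearMap.restrict_apply, mul_assoc, hκ]
  have h1 := key 1
  have hone : ∀ g : Perm (Fin μ.card), g⁻¹ * (1 : Perm (Fin μ.card))⁻¹ * g = 1 := by simp
  simp only [hone, coeff_youngSymmetrizer_one, Finset.sum_const, Finset.card_univ,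
    Fintype.card_perm, Fintype.card_fin, nsmul_eq_mul, mul_one] at h1
  have hf : (μ.card.factorial : ℚ) ≠ 0 := by exact_mod_cast μ.card.factorial_ne_zero
  have hκ0 : κ ≠ 0 := by rintro rfl; simp at h1; exact hf h1.symm
  rw [← key, ← h1, mul_div_mul_left _ _ hκ0]

theorem descFactorial_mul_sum_perm_embedding {n k : ℕ} (e : Fin k ↪ Fin n)
    (Φ : (Fin k ↪ Fin n) → ℚ) :
    (n.descFactorial k : ℚ) * ∑ g : Perm (Fin n), Φ (e.trans g.toEmbedding) =
      (n.factorial : ℚ) * ∑ f, Φ f := by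
  classical
  have hconst : ∀ f : Fin k ↪ Fin n,
      (Finset.univ.filter fun g : Perm (Fin n) => e.trans g.toEmbedding = f).card =
      (Finset.univ.filter fun g : Perm (Fin n) => e.trans g.toEmbedding = e).card := by
    intro f
    have := Equiv.Perm.isMultiplyPretransitive (Fin n) k
    obtain ⟨h, hh⟩ := MulAction.exists_smul_eq (Perm (Fin n)) f e
    have hh' : ∀ a, h (f a) = e a := fun a => by rw [← hh]; rfl
    refine Finset.card_bij (fun g _ => h * g) ?_ ?_ ?_
    · intro g hg
      simp only [Finset.mem_filter, Finset.mem_univ, true_and] at hg ⊢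
      ext a : 1
      rw [← hh' a, ← hg]
      rfl
    · intro g _ g' _ hgg
      exact mul_left_cancel hgg
    · intro g hg
      simp only [Finset.mem_filter, Finset.mem_univ, true_and] at hg
      refine ⟨h⁻¹ * g, ?_, by simp⟩
      simp only [Finset.mem_filter, Finset.mem_univ, true_and]
      ext a : 1
      have : g (e a) = h (f a) := by rw [hh']; exact DFunLike.congr_fun hg a
      change h⁻¹ (g (e a)) = f a
      rw [this]
      simp
  set M := (Finset.univ.filter fun g : Perm (Fin n) => e.trans g.toEmbedding = e).card
  have hsum : ∀ Ψ : (Fin k ↪ Fin n) → ℚ,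
      ∑ g : Perm (Fin n), Ψ (e.trans g.toEmbedding) = M * ∑ f, Ψ f := by
    intro Ψ
    rw [← Finset.sum_fiberwise Finset.univ (fun g : Perm (Fin n) => e.trans g.toEmbedding),
      Finset.mul_sum]
    refine Finset.sum_congr rfl fun f _ => ?_
    rw [← hconst f, ← nsmul_eq_mul, ← Finset.sum_const]
    refine Finset.sum_congr rfl fun g hg => ?_
    rw [(Finset.mem_filter.1 hg).2]
  have h1 := hsum fun _ => 1
  simp only [Finset.sum_const, Finset.card_univ, Fintype.card_perm, Fintype.card_fin,
    Fintype.card_embedding_eq, nsmul_eq_mul, mul_one] at h1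
  rw [hsum, h1]
  ring

theorem inv_mul_viaEmbedding_mul {n k : ℕ} (e : Fin k ↪ Fin n) (g : Perm (Fin n))
    (π : Perm (Fin k)) :
    g⁻¹ * (π.viaEmbedding e)⁻¹ * g = π⁻¹.viaEmbedding (e.trans g⁻¹.toEmbedding) := by
  have hinv : (π.viaEmbedding e)⁻¹ = π⁻¹.viaEmbedding e :=
    (map_inv (Equiv.Perm.viaEmbeddingHom e) π).symm
  rw [hinv]
  ext x : 1
  by_cases hx : x ∈ Set.range (e.trans g⁻¹.toEmbedding)
  · obtain ⟨a, rfl⟩ := hx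
    rw [Equiv.Perm.viaEmbedding_apply]
    simp [Equiv.Perm.viaEmbedding_apply]
  · rw [Equiv.Perm.viaEmbedding_apply_of_notMem _ _ _ hx, Equiv.Perm.mul_apply,
      Equiv.Perm.mul_apply, Equiv.Perm.viaEmbedding_apply_of_notMem]
    · simp
    · rintro ⟨a, ha⟩
      exact hx ⟨a, by simp [ha]⟩

theorem isRowPerm_viaEmbedding {μ : YoungDiagram} {k : ℕ} (f : Fin k ↪ Fin μ.card)
    (σ : Perm (Fin k)) :
    IsRowPerm μ (σ.viaEmbedding f) ↔ ∀ a, rowOf μ (f (σ a)) = rowOf μ (f a) := by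
  constructor
  · intro h a
    rw [← Equiv.Perm.viaEmbedding_apply]
    exact h _
  · intro h x
    by_cases hx : x ∈ Set.range f
    · obtain ⟨a, rfl⟩ := hx
      rw [Equiv.Perm.viaEmbedding_apply, h]
    · rw [Equiv.Perm.viaEmbedding_apply_of_notMem _ _ _ hx]

theorem isColPerm_viaEmbedding {μ : YoungDiagram} {k : ℕ} (f : Fin k ↪ Fin μ.card)
    (σ : Perm (Fin k)) :
    IsColPerm μ (σ.viaEmbedding f) ↔ ∀ a, colOf μ (f (σ a)) = colOf μ (f a) := by
  constructor
  · intro h a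
    rw [← Equiv.Perm.viaEmbedding_apply]
    exact h _
  · intro h x
    by_cases hx : x ∈ Set.range f
    · obtain ⟨a, rfl⟩ := hx
      rw [Equiv.Perm.viaEmbedding_apply, h]
    · rw [Equiv.Perm.viaEmbedding_apply_of_notMem _ _ _ hx]

theorem exists_viaEmbedding_eq {n k : ℕ} (f : Fin k ↪ Fin n) (p : Perm (Fin n))
    (hp : ∀ x, x ∉ Set.range f → p x = x) : ∃ σ : Perm (Fin k), σ.viaEmbedding f = p := by
  have hmem : ∀ a, p (f a) ∈ Set.range f := by
    intro a
    by_contra h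
    exact h ⟨a, (p.injective (hp _ h)).symm⟩
  choose s hs using hmem
  have hinj : Function.Injective s := fun a b hab =>
    f.injective (p.injective (by rw [← hs, ← hs, hab]))
  refine ⟨Equiv.ofBijective s (Finite.injective_iff_bijective.1 hinj), Equiv.ext fun x => ?_⟩
  by_cases hx : x ∈ Set.range f
  · obtain ⟨a, rfl⟩ := hx
    rw [Equiv.Perm.viaEmbedding_apply]
    exact hs a
  · rw [Equiv.Perm.viaEmbedding_apply_of_notMem _ _ _ hx, hp x hx]

/-- The signed number of factorizations `ρ = σ * τ` where `σ` preserves the rows and `τ` the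
columns of the boxes chosen by `f`. -/
noncomputable def factorizationSum (μ : YoungDiagram) {k : ℕ} (ρ : Perm (Fin k))
    (f : Fin k → Fin μ.card) : ℚ :=
  ∑ σ : Perm (Fin k),
    if (∀ a, rowOf μ (f (σ a)) = rowOf μ (f a)) ∧
        (∀ a, colOf μ (f ((σ⁻¹ * ρ) a)) = colOf μ (f a))
    then ((Perm.sign (σ⁻¹ * ρ) : ℤ) : ℚ) else 0

theorem sign_viaEmbedding {n k : ℕ} (f : Fin k ↪ Fin n) (σ : Perm (Fin k)) :
    Perm.sign (σ.viaEmbedding f) = Perm.sign σ := by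
  classical
  rw [Equiv.Perm.viaEmbedding, Equiv.Perm.sign_extendDomain]

theorem coeff_youngSymmetrizer_viaEmbedding (μ : YoungDiagram) {k : ℕ} (ρ : Perm (Fin k))
    (f : Fin k ↪ Fin μ.card) :
    (youngSymmetrizer μ).coeff (ρ.viaEmbedding f) = factorizationSum μ ρ f := by
  classical
  have hmul : ∀ σ τ : Perm (Fin k),
      σ.viaEmbedding f * τ.viaEmbedding f = (σ * τ).viaEmbedding f := fun σ τ =>
    (map_mul (Equiv.Perm.viaEmbeddingHom f) σ τ).symm
  have hvinj : Function.Injective fun σ : Perm (Fin k) => σ.viaEmbedding f :=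
    Equiv.Perm.viaEmbeddingHom_injective f
  rw [coeff_youngSymmetrizer, factorizationSum]
  symm
  rw [← Fintype.sum_prod_type']
  refine Finset.sum_of_injOn
    (fun σ : Perm (Fin k) => (σ.viaEmbedding f, (σ⁻¹ * ρ).viaEmbedding f)) ?_ ?_ ?_ ?_
  · intro σ _ σ' _ h
    exact hvinj (Prod.ext_iff.1 h).1
  · intro σ _
    simp
  · rintro ⟨p, q⟩ _ hpq
    refine if_neg ?_
    rintro ⟨hp, hq, h⟩
    have hfix : ∀ x, x ∉ Set.range f → p x = x ∧ q x = x := fun x hx =>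
      eq_of_isRowPerm_mul_isColPerm hp hq
        (by rw [h]; exact Equiv.Perm.viaEmbedding_apply_of_notMem _ _ _ hx)
    obtain ⟨σ, rfl⟩ := exists_viaEmbedding_eq f p fun x hx => (hfix x hx).1
    obtain ⟨τ, rfl⟩ := exists_viaEmbedding_eq f q fun x hx => (hfix x hx).2
    rw [hmul] at h
    have h' : σ * τ = ρ := hvinj h
    refine hpq ⟨σ, by simp, ?_⟩
    simp [← h']
  · intro σ _
    simp only [isRowPerm_viaEmbedding, isColPerm_viaEmbedding, hmul, mul_inv_cancel_left, and_true,
      sign_viaEmbedding]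

theorem factorizationSum_eq_zero (μ : YoungDiagram) {k : ℕ} (ρ : Perm (Fin k))
    (f : Fin k → Fin μ.card) (hf : ¬ Function.Injective f) : factorizationSum μ ρ f = 0 := by
  classical
  rw [Function.not_injective_iff] at hf
  obtain ⟨a, b, hab, hne⟩ := hf
  have ht : ∀ x, f (Equiv.swap a b x) = f x := by
    intro x
    by_cases hxa : x = a
    · subst hxa; rw [Equiv.swap_apply_left, hab]
    · by_cases hxb : x = b
      · subst hxb; rw [Equiv.swap_apply_right, hab]
      · rw [Equiv.swap_apply_of_ne_of_ne hxa hxb]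
  have hrow : ∀ σ : Perm (Fin k),
      (∀ x, rowOf μ (f ((σ * Equiv.swap a b) x)) = rowOf μ (f x)) ↔
      ∀ x, rowOf μ (f (σ x)) = rowOf μ (f x) := by
    intro σ
    constructor
    · intro h x
      have := h (Equiv.swap a b x)
      rwa [Equiv.Perm.mul_apply, Equiv.swap_apply_self, ht] at this
    · intro h x
      rw [Equiv.Perm.mul_apply, h, ht]
  have hcol : ∀ σ : Perm (Fin k),
      (∀ x, colOf μ (f (((σ * Equiv.swap a b)⁻¹ * ρ) x)) = colOf μ (f x)) ↔
      ∀ x, colOf μ (f ((σ⁻¹ * ρ) x)) = colOf μ (f x) := by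
    intro σ
    simp only [mul_inv_rev, Equiv.swap_inv, mul_assoc]
    simp only [Equiv.Perm.mul_apply (Equiv.swap a b), ht]
  refine Finset.sum_involution (fun σ _ => σ * Equiv.swap a b) ?_ ?_ ?_ ?_
  · intro σ _
    simp only [hrow, hcol]
    split_ifs
    · simp [Equiv.Perm.sign_swap hne]
    · simp
  · intro σ _ _ h
    have : Equiv.swap a b = 1 := mul_left_cancel (h.trans (mul_one σ).symm)
    exact hne (Equiv.swap_eq_one_iff.1 this)
  · simp
  · intro σ _
    simp [mul_assoc]

/-- The maps from points to boxes of `μ` whose rows are constant on the cycles of `σ` and whose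
columns are constant on the cycles of `τ`. -/
def cellMaps (μ : YoungDiagram) {k : ℕ} (σ τ : Perm (Fin k)) : Finset (Fin k → ℕ × ℕ) :=
  (Fintype.piFinset fun _ => μ.cells).filter fun f =>
    (∀ a, (f (σ a)).1 = (f a).1) ∧ ∀ a, (f (τ a)).2 = (f a).2

theorem mem_cellMaps {μ : YoungDiagram} {k : ℕ} {σ τ : Perm (Fin k)} {f : Fin k → ℕ × ℕ} :
    f ∈ cellMaps μ σ τ ↔ (∀ a, f a ∈ μ.cells) ∧ (∀ a, (f (σ a)).1 = (f a).1) ∧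
      ∀ a, (f (τ a)).2 = (f a).2 := by
  simp [cellMaps]

theorem card_cellMaps (μ : YoungDiagram) {k : ℕ} (σ τ : Perm (Fin k)) :
    (cellMaps μ σ τ).card = (Finset.univ.filter fun f : Fin k → Fin μ.card =>
      (∀ a, rowOf μ (f (σ a)) = rowOf μ (f a)) ∧
        ∀ a, colOf μ (f (τ a)) = colOf μ (f a)).card := by
  symm
  refine Finset.card_bij (fun f _ a => (rowOf μ (f a), colOf μ (f a))) ?_ ?_ ?_
  · intro f hf
    simp only [Finset.mem_filter, Finset.mem_univ, true_and] at hf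
    exact mem_cellMaps.2 ⟨fun a => rowOf_colOf_mem μ _, hf⟩
  · intro f _ f' _ h
    funext a
    have := Prod.ext_iff.1 (congrFun h a)
    exact eq_of_rowOf_eq_of_colOf_eq this.1 this.2
  · intro f hf
    obtain ⟨h1, h2, h3⟩ := mem_cellMaps.1 hf
    choose g hg hg' using fun a => exists_rowOf_colOf (i := (f a).1) (j := (f a).2) (h1 a)
    refine ⟨g, ?_, ?_⟩
    · simp only [Finset.mem_filter, Finset.mem_univ, true_and, hg, hg']
      exact ⟨h2, h3⟩
    · funext a
      rw [hg, hg']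

theorem normChar_eq_sum_embedding {k : ℕ} (μ : YoungDiagram) (π : Perm (Fin k)) :
    normChar μ π = ∑ f : Fin k ↪ Fin μ.card, factorizationSum μ π⁻¹ f := by
  unfold normChar
  split_ifs with h
  · rw [mul_div_assoc, irrChar_div_irrChar_one, ← mul_div_assoc]
    simp only [inv_mul_viaEmbedding_mul, coeff_youngSymmetrizer_viaEmbedding]
    have hinv : ∑ g : Perm (Fin μ.card), factorizationSum μ π⁻¹
          ((Fin.castLEEmb h).trans g⁻¹.toEmbedding) =
        ∑ g : Perm (Fin μ.card), factorizationSum μ π⁻¹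
          ((Fin.castLEEmb h).trans g.toEmbedding) :=
      Fintype.sum_equiv (Equiv.inv _) _ _ fun g => rfl
    rw [hinv, descFactorial_mul_sum_perm_embedding (Fin.castLEEmb h)
      (fun f => factorizationSum μ π⁻¹ f), mul_div_cancel_left₀]
    exact_mod_cast μ.card.factorial_ne_zero
  · have : IsEmpty (Fin k ↪ Fin μ.card) :=
      ⟨fun f => h (by simpa using Fintype.card_le_of_embedding f)⟩
    simp

/-- Stanley's character formula. -/
theorem normChar_eq_sum_cellMaps {k : ℕ} (μ : YoungDiagram) (π : Perm (Fin k)) :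
    normChar μ π = ∑ σ : Perm (Fin k),
      ((Perm.sign (σ⁻¹ * π⁻¹) : ℤ) : ℚ) * (cellMaps μ σ (σ⁻¹ * π⁻¹)).card := by
  classical
  have h1 : ∑ f : Fin k ↪ Fin μ.card, factorizationSum μ π⁻¹ f =
      ∑ f : Fin k → Fin μ.card, factorizationSum μ π⁻¹ f := by
    refine Finset.sum_of_injOn (fun f : Fin k ↪ Fin μ.card => (f : Fin k → Fin μ.card))
      (fun f _ g _ h => DFunLike.coe_injective h) (fun f _ => by simp) ?_ fun f _ => rfl
    intro f _ hf
    exact factorizationSum_eq_zero μ _ f fun hinj => hf ⟨⟨f, hinj⟩, by simp, rfl⟩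
  rw [normChar_eq_sum_embedding, h1]
  simp only [factorizationSum]
  rw [Finset.sum_comm]
  refine Finset.sum_congr rfl fun σ _ => ?_
  rw [card_cellMaps, ← Finset.sum_filter, Finset.sum_const, nsmul_eq_mul, mul_comm]

/-- Evaluation of `f` at `n`, arranged so that the kernel normalizes `n` first. -/
def force {α : Type} (n : ℕ) (f : ℕ → α) : α := Nat.rec (f 0) (fun m _ => f (m + 1)) n

theorem force_eq {α : Type} (n : ℕ) (f : ℕ → α) : force n f = f n := by
  cases n <;> rfl

/-- The least element among `m` and the iterates `s a, s (s a), …, s^[n] a`. -/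
def orbitMin (s : ℕ → ℕ) : ℕ → ℕ → ℕ → ℕ
  | 0, _, m => m
  | n + 1, a, m => force (s a) fun b => bif Nat.ble m b then orbitMin s n b m else orbitMin s n b b

theorem orbitMin_succ (s : ℕ → ℕ) (n a m : ℕ) :
    orbitMin s (n + 1) a m = orbitMin s n (s a) (min m (s a)) := by
  rw [orbitMin, force_eq]
  by_cases h : m ≤ s a
  · rw [Nat.ble_eq_true_of_le h, min_eq_left h]; rfl
  · have : Nat.ble m (s a) = false := by
      rw [Bool.eq_false_iff]
      exact fun h' => h (Nat.le_of_ble_eq_true h')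
    rw [this, min_eq_right (by omega)]; rfl

theorem orbitMin_congr {k : ℕ} {s t : ℕ → ℕ} (hs : ∀ a < k, s a < k) (h : ∀ a < k, s a = t a)
    (n : ℕ) : ∀ a < k, ∀ m, orbitMin s n a m = orbitMin t n a m := by
  induction n with
  | zero => intro a _ m; rfl
  | succ n ih =>
    intro a ha m
    rw [orbitMin_succ, orbitMin_succ, ih _ (hs a ha), h a ha]

theorem orbitMin_le (s : ℕ → ℕ) (n : ℕ) : ∀ a m, orbitMin s n a m ≤ m ∧
    ∀ j < n, orbitMin s n a m ≤ s^[j + 1] a := by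
  induction n with
  | zero => intro a m; simp [orbitMin]
  | succ n ih =>
    intro a m
    rw [orbitMin_succ]
    have := ih (s a) (min m (s a))
    refine ⟨this.1.trans (min_le_left _ _), fun j hj => ?_⟩
    cases j with
    | zero => exact this.1.trans (min_le_right _ _)
    | succ j => exact this.2 j (by omega)

theorem orbitMin_mem (s : ℕ → ℕ) (n : ℕ) : ∀ a m, orbitMin s n a m = m ∨
    ∃ j, orbitMin s n a m = s^[j] a := by
  induction n with
  | zero => intro a m; simp [orbitMin]
  | succ n ih =>
    intro a m
    rw [orbitMin_succ]
    rcases ih (s a) (min m (s a)) with h | ⟨j, h⟩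
    · rcases le_total m (s a) with h' | h'
      · left; rw [h, min_eq_left h']
      · right; exact ⟨1, by rw [h, min_eq_right h']; rfl⟩
    · exact Or.inr ⟨j + 1, h⟩

/-- The extension of a permutation of `{0, …, k - 1}` to the natural numbers. -/
def toNatFun {k : ℕ} (σ : Perm (Fin k)) (a : ℕ) : ℕ := if h : a < k then σ ⟨a, h⟩ else a

theorem toNatFun_coe {k : ℕ} (σ : Perm (Fin k)) (a : Fin k) : toNatFun σ a = σ a := by
  simp [toNatFun]

theorem iterate_toNatFun_coe {k : ℕ} (σ : Perm (Fin k)) (j : ℕ) (a : Fin k) :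
    (toNatFun σ)^[j] a = ((σ ^ j) a : Fin k) := by
  induction j with
  | zero => rfl
  | succ j ih => rw [Function.iterate_succ_apply', ih, toNatFun_coe, pow_succ']; rfl

/-- The least element of the cycle of `σ` through `a`. -/
def label {k : ℕ} (σ : Perm (Fin k)) (a : ℕ) : ℕ := orbitMin (toNatFun σ) k a a

theorem exists_label_eq {k : ℕ} (σ : Perm (Fin k)) (a : Fin k) :
    ∃ b : Fin k, label σ a = b ∧ σ.SameCycle a b := by
  rcases orbitMin_mem (toNatFun σ) k a a with h | ⟨j, h⟩
  · exact ⟨a, h, Equiv.Perm.SameCycle.refl _ _⟩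
  · exact ⟨(σ ^ j) a, h.trans (iterate_toNatFun_coe σ j a), ⟨j, rfl⟩⟩

theorem label_le {k : ℕ} {σ : Perm (Fin k)} {a b : Fin k} (h : σ.SameCycle a b) :
    label σ a ≤ b := by
  have hle := orbitMin_le (toNatFun σ) k a a
  by_cases ha : σ a = a
  · obtain ⟨i, rfl⟩ := h
    rw [Equiv.Perm.zpow_apply_eq_self_of_apply_eq_self ha]
    exact hle.1
  · obtain ⟨i, hi, hb⟩ := h.exists_pow_eq_of_mem_support (Equiv.Perm.mem_support.2 ha)
    have hik : i < k := hi.trans_le (by simpa using Finset.card_le_univ (σ.cycleOf a).support)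
    cases i with
    | zero =>
      have : a = b := hb
      exact this ▸ hle.1
    | succ i =>
      have := hle.2 i (by omega)
      rwa [iterate_toNatFun_coe, hb] at this

theorem label_eq_of_sameCycle {k : ℕ} {σ : Perm (Fin k)} {a b : Fin k} (h : σ.SameCycle a b) :
    label σ a = label σ b := by
  apply le_antisymm
  · obtain ⟨c, hc, hbc⟩ := exists_label_eq σ b
    rw [hc]; exact label_le (h.trans hbc)
  · obtain ⟨c, hc, hac⟩ := exists_label_eq σ a
    rw [hc]; exact label_le (h.symm.trans hac)

theorem label_apply {k : ℕ} (σ : Perm (Fin k)) (a : Fin k) : label σ (σ a : Fin k) = label σ a :=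
  (label_eq_of_sameCycle ⟨1, by simp⟩).symm

theorem label_lt {k : ℕ} (σ : Perm (Fin k)) (a : Fin k) : label σ a < k := by
  obtain ⟨b, hb, -⟩ := exists_label_eq σ a
  rw [hb]; exact b.2

theorem label_label {k : ℕ} (σ : Perm (Fin k)) (a : Fin k) : label σ (label σ a) = label σ a := by
  obtain ⟨b, hb, h⟩ := exists_label_eq σ a
  conv_lhs => rw [hb]
  exact (label_eq_of_sameCycle h).symm

theorem apply_label {k : ℕ} {σ : Perm (Fin k)} {α : Type*} {h : Fin k → α}
    (hh : ∀ a, h (σ a) = h a) (a : Fin k) : h ⟨label σ a, label_lt σ a⟩ = h a := by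
  obtain ⟨b, hb, i, hi⟩ := exists_label_eq σ a
  have hpow : ∀ j : ℕ, ∀ c, h ((σ ^ j) c) = h c := by
    intro j
    induction j with
    | zero => intro c; rfl
    | succ j ih => intro c; rw [pow_succ', Equiv.Perm.mul_apply, hh, ih]
  have hb' : (⟨label σ a, label_lt σ a⟩ : Fin k) = b := Fin.ext hb
  rw [hb', ← hi]
  cases i with
  | ofNat j => exact hpow j a
  | negSucc j =>
    rw [zpow_negSucc, ← hpow (j + 1) ((σ ^ (j + 1))⁻¹ a), ← Equiv.Perm.mul_apply, mul_inv_cancel, Equiv.Perm.one_apply]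

/-- The number of fixed points of `u` below `k`; for `u = label σ`, the number of cycles. -/
def labelCount (k : ℕ) (u : ℕ → ℕ) : ℕ := ((Finset.range k).filter fun a => u a = a).card

/-- The number of classes of the labelling `v` contained in the class of `0` for `u`. -/
def insideCount (k : ℕ) (u v : ℕ → ℕ) : ℕ :=
  ((Finset.range k).filter fun b => v b = b ∧ ∀ a < k, v a = b → u a = 0).card

/-- The number of classes of the labelling `v` disjoint from the class of `0` for `u`. -/
def outsideCount (k : ℕ) (u v : ℕ → ℕ) : ℕ :=
  ((Finset.range k).filter fun b => v b = b ∧ ∀ a < k, v a = b → u a ≠ 0).card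

/-- The `σ`-invariant functions bounded by `g`. -/
def boundedInvariants {k : ℕ} (σ : Perm (Fin k)) (g : Fin k → ℕ) : Finset (Fin k → ℕ) :=
  (Fintype.piFinset fun a => Finset.range (g a)).filter fun h => ∀ a, h (σ a) = h a

theorem mem_boundedInvariants {k : ℕ} {σ : Perm (Fin k)} {g h : Fin k → ℕ} :
    h ∈ boundedInvariants σ g ↔ (∀ a, h a < g a) ∧ ∀ a, h (σ a) = h a := by
  simp [boundedInvariants]

theorem card_boundedInvariants {k : ℕ} (σ : Perm (Fin k)) (g : Fin k → ℕ) (m : ℕ → ℕ)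
    (hm : ∀ b < k, label σ b = b → ∀ x, x < m b ↔ ∀ a : Fin k, label σ a = b → x < g a) :
    (boundedInvariants σ g).card =
      ∏ b ∈ (Finset.range k).filter fun a => label σ a = a, m b := by
  set B := (Finset.range k).filter fun a => label σ a = a with hB
  have hBk : ∀ b ∈ B, b < k ∧ label σ b = b := fun b hb => by simpa [hB] using hb
  have hlabB : ∀ a : Fin k, label σ a ∈ B := fun a => by simp [hB, label_lt, label_label]
  rw [← Finset.prod_attach, ← Finset.card_range (∏ x ∈ B.attach, m x), Finset.card_range]
  have : ∏ x ∈ B.attach, m x = (Fintype.piFinset fun b : B => Finset.range (m b)).card := by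
    simp
  rw [this]
  refine Finset.card_nbij' (fun h b => h ⟨b, (hBk b b.2).1⟩) (fun φ a => φ ⟨label σ a, hlabB a⟩)
    ?_ ?_ ?_ ?_
  · intro h hh
    obtain ⟨h1, h2⟩ := mem_boundedInvariants.1 hh
    simp only [Finset.mem_coe, Fintype.mem_piFinset, Finset.mem_range]
    intro b
    rw [hm b (hBk b b.2).1 (hBk b b.2).2]
    intro a ha
    have := apply_label h2 a
    simp only [ha] at this
    rw [this]
    exact h1 a
  · intro φ hφ
    simp only [Finset.mem_coe, Fintype.mem_piFinset, Finset.mem_range] at hφ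
    simp only [Finset.mem_coe, mem_boundedInvariants, label_apply]
    exact ⟨fun a => (hm _ (label_lt σ a) (label_label σ a) _).1 (hφ _) a rfl, fun _ => trivial⟩
  · intro h hh
    obtain ⟨h1, h2⟩ := mem_boundedInvariants.1 hh
    funext a
    exact apply_label h2 a
  · intro φ hφ
    funext b
    have := (hBk b b.2).2
    simp only [this]

theorem card_boundedInvariants_const {k : ℕ} (σ : Perm (Fin k)) (s : ℕ) :
    (boundedInvariants σ fun _ => s).card = s ^ labelCount k (label σ) := by
  rw [card_boundedInvariants σ _ (fun _ => s), Finset.prod_const, labelCount]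
  intro b hb hbl x
  exact ⟨fun h _ _ => h, fun h => h ⟨b, hb⟩ hbl⟩

theorem card_cellMaps_eq_sum {k : ℕ} (μ : YoungDiagram) (σ τ : Perm (Fin k)) :
    (cellMaps μ σ τ).card = ∑ ρ ∈ boundedInvariants σ fun _ => μ.colLen 0,
      (boundedInvariants τ fun a => μ.rowLen (ρ a)).card := by
  rw [← Finset.card_sigma]
  refine Finset.card_nbij' (fun f => ⟨fun a => (f a).1, fun a => (f a).2⟩)
    (fun p a => (p.1 a, p.2 a)) ?_ ?_ ?_ ?_
  · intro f hf
    obtain ⟨h1, h2, h3⟩ := mem_cellMaps.1 hf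
    simp only [Finset.mem_coe, Finset.mem_sigma, mem_boundedInvariants]
    refine ⟨⟨fun a => ?_, h2⟩, fun a => YoungDiagram.mem_iff_lt_rowLen.1 (h1 a), h3⟩
    exact YoungDiagram.mem_iff_lt_colLen.1
      (μ.up_left_mem le_rfl (Nat.zero_le _) (h1 a : ((f a).1, (f a).2) ∈ μ))
  · rintro ⟨ρ, h⟩ hp
    simp only [Finset.mem_coe, Finset.mem_sigma, mem_boundedInvariants] at hp
    exact mem_cellMaps.2 ⟨fun a => YoungDiagram.mem_iff_lt_rowLen.2 (hp.2.1 a), hp.1.2, hp.2.2⟩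
  · intro f _; rfl
  · intro p _; rfl

theorem card_cellMaps_transpose {k : ℕ} (μ : YoungDiagram) (σ τ : Perm (Fin k)) :
    (cellMaps μ.transpose τ σ).card = (cellMaps μ σ τ).card := by
  refine Finset.card_nbij' (fun f a => (f a).swap) (fun f a => (f a).swap) ?_ ?_ ?_ ?_
  · intro f hf
    obtain ⟨h1, h2, h3⟩ := mem_cellMaps.1 hf
    exact mem_cellMaps.2 ⟨fun a => YoungDiagram.mem_transpose.1 (h1 a), h3, h2⟩
  · intro f hf
    obtain ⟨h1, h2, h3⟩ := mem_cellMaps.1 hf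
    exact mem_cellMaps.2 ⟨fun a => YoungDiagram.mem_transpose.2 (by simpa using h1 a), h3, h2⟩
  · intro f _; simp
  · intro f _; simp

theorem mem_cells_dilate {μ : YoungDiagram} {s : ℕ} (hs : 0 < s) {c : ℕ × ℕ} :
    c ∈ (dilate μ s).cells ↔ (c.1 / s, c.2 / s) ∈ μ.cells := by
  simp only [dilate, Finset.mem_filter, Finset.mem_product, Finset.mem_range, and_iff_right_iff_imp]
  intro h
  have h1 := YoungDiagram.mem_iff_lt_colLen.1 (μ.up_left_mem le_rfl (Nat.zero_le _) h)
  have h2 := YoungDiagram.mem_iff_lt_rowLen.1 (μ.up_left_mem (Nat.zero_le _) le_rfl h)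
  rw [Nat.div_lt_iff_lt_mul hs] at h1 h2
  exact ⟨by rwa [mul_comm], by rwa [mul_comm]⟩

theorem card_cellMaps_dilate {k : ℕ} (μ : YoungDiagram) {s : ℕ} (hs : 0 < s)
    (σ τ : Perm (Fin k)) : (cellMaps (dilate μ s) σ τ).card =
      s ^ (labelCount k (label σ) + labelCount k (label τ)) * (cellMaps μ σ τ).card := by
  rw [pow_add, ← card_boundedInvariants_const, ← card_boundedInvariants_const,
    ← Finset.card_product, ← Finset.card_product]
  refine Finset.card_nbij'
    (fun f => ((fun a => (f a).1 % s, fun a => (f a).2 % s), fun a => ((f a).1 / s, (f a).2 / s)))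
    (fun p a => ((p.2 a).1 * s + p.1.1 a, (p.2 a).2 * s + p.1.2 a)) ?_ ?_ ?_ ?_
  · intro f hf
    obtain ⟨h1, h2, h3⟩ := mem_cellMaps.1 hf
    simp only [Finset.mem_coe, Finset.mem_product, mem_boundedInvariants, mem_cellMaps]
    refine ⟨⟨⟨fun a => Nat.mod_lt _ hs, fun a => ?_⟩, fun a => Nat.mod_lt _ hs, fun a => ?_⟩,
      fun a => (mem_cells_dilate hs).1 (h1 a), fun a => ?_, fun a => ?_⟩
    · rw [h2]
    · rw [h3]
    · rw [h2]
    · rw [h3]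
  · rintro ⟨⟨x, y⟩, f⟩ hp
    simp only [Finset.mem_coe, Finset.mem_product, mem_boundedInvariants, mem_cellMaps] at hp
    obtain ⟨⟨⟨hx, hx'⟩, hy, hy'⟩, h1, h2, h3⟩ := hp
    refine mem_cellMaps.2 ⟨fun a => (mem_cells_dilate hs).2 ?_, fun a => ?_, fun a => ?_⟩
    · simpa [Nat.add_div_of_dvd_right, Nat.mul_div_cancel _ hs,
        Nat.div_eq_of_lt (hx a), Nat.div_eq_of_lt (hy a)] using h1 a
    · simp only [h2, hx']
    · simp only [h3, hy']
  · intro f _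
    funext a
    ext <;> simp [Nat.div_add_mod']
  · rintro ⟨⟨x, y⟩, f⟩ hp
    simp only [Finset.mem_coe, Finset.mem_product, mem_boundedInvariants, mem_cellMaps] at hp
    obtain ⟨⟨⟨hx, hx'⟩, hy, hy'⟩, h1, h2, h3⟩ := hp
    simp [Nat.add_div_of_dvd_right, Nat.mul_div_cancel _ hs, Nat.mod_eq_of_lt (hx _),
        Nat.div_eq_of_lt (hx _), Nat.div_eq_of_lt (hy _), Nat.mod_eq_of_lt (hy _)]

/-- The second factor `τ` in the factorization `σ * τ = (finRotate k)⁻¹`. -/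
def cofactor {k : ℕ} (σ : Perm (Fin k)) : Perm (Fin k) := σ⁻¹ * (finRotate k)⁻¹

/-- The total number of cycles of the two factors of the factorization starting with `σ`. -/
def totalCycles {k : ℕ} (σ : Perm (Fin k)) : ℕ :=
  labelCount k (label σ) + labelCount k (label (cofactor σ))

/-- The contribution of `σ` to the normalized character on the long cycle. -/
def stanleyTerm (μ : YoungDiagram) {k : ℕ} (σ : Perm (Fin k)) : ℚ :=
  ((Perm.sign (cofactor σ) : ℤ) : ℚ) * (cellMaps μ σ (cofactor σ)).card

/-- The part of degree `d` of the normalized character on the `k`-cycle. -/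
def gradedSigma (μ : YoungDiagram) (k d : ℕ) : ℚ :=
  ∑ σ : Perm (Fin k), if totalCycles σ = d then stanleyTerm μ σ else 0

theorem SigmaCycle_eq_sum (μ : YoungDiagram) (k : ℕ) :
    SigmaCycle μ k = ∑ σ : Perm (Fin k), stanleyTerm μ σ :=
  normChar_eq_sum_cellMaps μ (finRotate k)

theorem SigmaCycle_dilate (μ : YoungDiagram) (k : ℕ) {s : ℕ} (hs : 0 < s) :
    SigmaCycle (dilate μ s) k = Polynomial.eval (s : ℚ)
      (∑ σ : Perm (Fin k), Polynomial.C (stanleyTerm μ σ) * Polynomial.X ^ totalCycles σ) := by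
  rw [SigmaCycle_eq_sum, Polynomial.eval_finsetSum]
  refine Finset.sum_congr rfl fun σ _ => ?_
  simp only [stanleyTerm, card_cellMaps_dilate μ hs, Polynomial.eval_mul, Polynomial.eval_C,
    Polynomial.eval_pow, Polynomial.eval_X, totalCycles]
  push_cast
  ring

theorem freeCumulant_succ (μ : YoungDiagram) (k : ℕ) :
    freeCumulant μ (k + 1) = gradedSigma μ k (k + 1) := by
  have hex : ∃ p : Polynomial ℚ, ∀ s : ℕ, 0 < s →
      SigmaCycle (dilate μ s) (k + 1 - 1) = Polynomial.eval (s : ℚ) p :=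
    ⟨_, fun s hs => SigmaCycle_dilate μ k hs⟩
  rw [freeCumulant, dif_pos hex]
  have hp := hex.choose_spec
  set p := hex.choose
  have : p = ∑ σ : Perm (Fin k),
      Polynomial.C (stanleyTerm μ σ) * Polynomial.X ^ totalCycles σ := by
    refine Polynomial.eq_of_infinite_eval_eq _ _ ?_
    refine (Set.infinite_range_of_injective
      (f := fun n : ℕ => ((n + 1 : ℕ) : ℚ)) fun a b h => by simpa using h).mono ?_
    rintro _ ⟨n, rfl⟩
    exact (hp (n + 1) n.succ_pos).symm.trans (SigmaCycle_dilate μ k n.succ_pos)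
  rw [this, Polynomial.finsetSum_coeff, gradedSigma]
  refine Finset.sum_congr rfl fun σ _ => ?_
  rw [Polynomial.coeff_C_mul, Polynomial.coeff_X_pow]
  by_cases h : totalCycles σ = k + 1
  · simp [h]
  · simp [h, Ne.symm h]

theorem label_zero {k : ℕ} (σ : Perm (Fin (k + 1))) : label σ 0 = 0 := by
  have := label_le (Perm.SameCycle.refl σ 0)
  simpa using this

theorem label_eq_zero {k : ℕ} {σ : Perm (Fin (k + 1))}
    (hσ : labelCount (k + 1) (label σ) = 1) (a : Fin (k + 1)) : label σ a = 0 := by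
  obtain ⟨b, hb⟩ := Finset.card_eq_one.1 hσ
  have h0 : (0 : ℕ) ∈ ({b} : Finset ℕ) := by
    rw [← hb]; simp [label_zero]
  have ha : label σ a ∈ ({b} : Finset ℕ) := by
    rw [← hb]
    exact Finset.mem_filter.2 ⟨Finset.mem_range.2 (label_lt σ a), label_label σ a⟩
  rw [Finset.mem_singleton] at h0 ha
  rw [ha, h0]

theorem exists_label_eq_or {k : ℕ} {σ : Perm (Fin (k + 1))}
    (hσ : labelCount (k + 1) (label σ) = 2) :
    ∃ c : Fin (k + 1), label σ c = c ∧ (c : ℕ) ≠ 0 ∧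
      ∀ a : Fin (k + 1), label σ a = 0 ∨ label σ a = c := by
  obtain ⟨x, y, hxy, h⟩ := Finset.card_eq_two.1 hσ
  have h0 : (0 : ℕ) ∈ ({x, y} : Finset ℕ) := by
    rw [← h]; simp [label_zero]
  have key : ∀ x y : ℕ, (Finset.range (k + 1)).filter (fun a => label σ a = a) = {x, y} →
      x ≠ y → x = 0 → ∃ c : Fin (k + 1), label σ c = c ∧ (c : ℕ) ≠ 0 ∧
      ∀ a : Fin (k + 1), label σ a = 0 ∨ label σ a = c := by
    rintro x y h hxy rfl
    have hy : y ∈ (Finset.range (k + 1)).filter (fun a => label σ a = a) := by simp [h]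
    rw [Finset.mem_filter, Finset.mem_range] at hy
    refine ⟨⟨y, hy.1⟩, hy.2, hxy.symm, fun a => ?_⟩
    have ha : label σ a ∈ (Finset.range (k + 1)).filter (fun a => label σ a = a) :=
      Finset.mem_filter.2 ⟨Finset.mem_range.2 (label_lt σ a), label_label σ a⟩
    simpa [h] using ha
  rw [Finset.mem_insert, Finset.mem_singleton] at h0
  rcases h0 with h0 | h0
  · exact key x y h hxy h0.symm
  · exact key y x (by rw [h, Finset.pair_comm]) hxy.symm h0.symm

theorem sum_boundedInvariants_of_labelCount_eq_one {k : ℕ} {σ : Perm (Fin (k + 1))}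
    (hσ : labelCount (k + 1) (label σ) = 1) (R : ℕ) (F : (Fin (k + 1) → ℕ) → ℕ) :
    ∑ ρ ∈ boundedInvariants σ (fun _ => R), F ρ = ∑ i ∈ Finset.range R, F fun _ => i := by
  symm
  refine Finset.sum_nbij' (fun i _ => i) (fun ρ => ρ 0) ?_ ?_ ?_ ?_ ?_
  · intro i hi
    simpa [mem_boundedInvariants] using hi
  · intro ρ hρ
    simpa using (mem_boundedInvariants.1 hρ).1 0
  · intro i _; rfl
  · intro ρ hρ
    funext a
    have := apply_label (mem_boundedInvariants.1 hρ).2 a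
    simpa [label_eq_zero hσ] using this
  · intro i _; rfl

theorem sum_boundedInvariants_of_labelCount_eq_two {k : ℕ} {σ : Perm (Fin (k + 1))}
    (hσ : labelCount (k + 1) (label σ) = 2) (R : ℕ) (F : (Fin (k + 1) → ℕ) → ℕ) :
    ∑ ρ ∈ boundedInvariants σ (fun _ => R), F ρ =
      ∑ i ∈ Finset.range R, ∑ j ∈ Finset.range R,
        F fun a => if label σ a = 0 then i else j := by
  obtain ⟨c, hc, hc0, hcl⟩ := exists_label_eq_or hσ
  rw [← Finset.sum_product', eq_comm]
  refine Finset.sum_nbij' (fun p a => if label σ a = 0 then p.1 else p.2)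
    (fun ρ => (ρ 0, ρ c)) ?_ ?_ ?_ ?_ ?_
  · rintro ⟨i, j⟩ hp
    simp only [Finset.mem_product, Finset.mem_range] at hp
    simp only [mem_boundedInvariants, label_apply, implies_true, and_true]
    intro a
    split_ifs
    exacts [hp.1, hp.2]
  · intro ρ hρ
    simpa using ⟨(mem_boundedInvariants.1 hρ).1 0, (mem_boundedInvariants.1 hρ).1 c⟩
  · rintro ⟨i, j⟩ _
    simp [label_zero, hc, hc0]
  · intro ρ hρ
    funext a
    have := apply_label (mem_boundedInvariants.1 hρ).2 a
    rcases hcl a with h | h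
    · simpa [h] using this
    · simpa [h, hc0] using this
  · intro i _; rfl

/-- The number of cell maps in which one permutation has a single cycle and the other `d` of
them. -/
def powerSum (μ : YoungDiagram) (d : ℕ) : ℕ := ∑ i ∈ Finset.range (μ.colLen 0), μ.rowLen i ^ d

/-- The number of cell maps in which the first permutation has two cycles, `p` cycles of the second
one meet only the first of them, `q` only the other, and `r` both. -/
def pairSum (μ : YoungDiagram) (p q r : ℕ) : ℕ :=
  ∑ i ∈ Finset.range (μ.colLen 0), ∑ j ∈ Finset.range (μ.colLen 0),
    μ.rowLen i ^ p * μ.rowLen j ^ q * min (μ.rowLen i) (μ.rowLen j) ^ r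

theorem card_cellMaps_of_labelCount_eq_one {k : ℕ} (μ : YoungDiagram) {σ : Perm (Fin (k + 1))}
    (hσ : labelCount (k + 1) (label σ) = 1) (τ : Perm (Fin (k + 1))) :
    (cellMaps μ σ τ).card = powerSum μ (labelCount (k + 1) (label τ)) := by
  rw [card_cellMaps_eq_sum, sum_boundedInvariants_of_labelCount_eq_one hσ _
    fun ρ => (boundedInvariants τ fun a => μ.rowLen (ρ a)).card, powerSum]
  exact Finset.sum_congr rfl fun i _ => card_boundedInvariants_const τ _

theorem card_cellMaps_of_labelCount_eq_two {k : ℕ} (μ : YoungDiagram) {σ : Perm (Fin (k + 1))}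
    (hσ : labelCount (k + 1) (label σ) = 2) (τ : Perm (Fin (k + 1))) :
    (cellMaps μ σ τ).card = pairSum μ (insideCount (k + 1) (label σ) (label τ))
      (outsideCount (k + 1) (label σ) (label τ))
      (labelCount (k + 1) (label τ) - insideCount (k + 1) (label σ) (label τ) -
        outsideCount (k + 1) (label σ) (label τ)) := by
  rw [card_cellMaps_eq_sum, sum_boundedInvariants_of_labelCount_eq_two hσ _
    fun ρ => (boundedInvariants τ fun a => μ.rowLen (ρ a)).card, pairSum]
  refine Finset.sum_congr rfl fun i _ => Finset.sum_congr rfl fun j _ => ?_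
  set B := (Finset.range (k + 1)).filter fun b => label τ b = b with hB
  let P : ℕ → Prop := fun b => ∀ a < (k + 1), label τ a = b → label σ a = 0
  let Q : ℕ → Prop := fun b => ∀ a < (k + 1), label τ a = b → label σ a ≠ 0
  have hP : insideCount (k + 1) (label σ) (label τ) = (B.filter P).card := by
    rw [hB, Finset.filter_filter]; rfl
  have hQ : outsideCount (k + 1) (label σ) (label τ) = ((B.filter fun b => ¬ P b).filter Q).card := by
    rw [hB, Finset.filter_filter, Finset.filter_filter, outsideCount]
    congr 1
    refine Finset.filter_congr fun b hb => ?_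
    constructor
    · rintro ⟨h1, h2⟩
      exact ⟨h1, fun h => h2 b (Finset.mem_range.1 hb) h1 (h b (Finset.mem_range.1 hb) h1), h2⟩
    · rintro ⟨h1, -, h2⟩
      exact ⟨h1, h2⟩
  have hr : labelCount (k + 1) (label τ) - insideCount (k + 1) (label σ) (label τ) -
      outsideCount (k + 1) (label σ) (label τ) =
        ((B.filter fun b => ¬ P b).filter fun b => ¬ Q b).card := by
    have h1 := Finset.card_filter_add_card_filter_not (s := B) P
    have h2 := Finset.card_filter_add_card_filter_not (s := B.filter fun b => ¬ P b) Q
    have h3 : labelCount (k + 1) (label τ) = B.card := rfl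
    omega
  rw [hr, hP, hQ, card_boundedInvariants τ _ (fun b => if P b then μ.rowLen i else
    if Q b then μ.rowLen j else min (μ.rowLen i) (μ.rowLen j)), ← hB,
    ← Finset.prod_filter_mul_prod_filter_not B P,
    ← Finset.prod_filter_mul_prod_filter_not (B.filter fun b => ¬ P b) Q, ← mul_assoc]
  · congr 1
    · congr 1
      · rw [Finset.prod_congr rfl (g := fun _ => μ.rowLen i), Finset.prod_const]
        intro b hb
        rw [if_pos (Finset.mem_filter.1 hb).2]
      · rw [Finset.prod_congr rfl (g := fun _ => μ.rowLen j), Finset.prod_const]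
        intro b hb
        simp only [Finset.mem_filter] at hb
        rw [if_neg hb.1.2, if_pos hb.2]
    · rw [Finset.prod_congr rfl (g := fun _ => min (μ.rowLen i) (μ.rowLen j)), Finset.prod_const]
      intro b hb
      simp only [Finset.mem_filter] at hb
      rw [if_neg hb.1.2, if_neg hb.2]
  · intro b hb hbl x
    have hPb : P b ↔ ∀ a : Fin (k + 1), label τ a = b → label σ a = 0 :=
      ⟨fun h a => h a a.2, fun h a ha => h ⟨a, ha⟩⟩
    have hQb : Q b ↔ ∀ a : Fin (k + 1), label τ a = b → label σ a ≠ 0 :=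
      ⟨fun h a => h a a.2, fun h a ha => h ⟨a, ha⟩⟩
    beta_reduce
    split_ifs with h1 h2
    · rw [hPb] at h1
      refine ⟨fun h a ha => by rwa [if_pos (h1 a ha)], fun h => ?_⟩
      have := h ⟨b, hb⟩ hbl
      rwa [if_pos (h1 ⟨b, hb⟩ hbl)] at this
    · rw [hQb] at h2
      refine ⟨fun h a ha => by rwa [if_neg (h2 a ha)], fun h => ?_⟩
      have := h ⟨b, hb⟩ hbl
      rwa [if_neg (h2 ⟨b, hb⟩ hbl)] at this
    · rw [hPb] at h1
      rw [hQb] at h2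
      push Not at h1 h2
      obtain ⟨a, ha, ha'⟩ := h1
      obtain ⟨a₁, ha₁, ha₁'⟩ := h2
      rw [lt_min_iff]
      constructor
      · intro h c _
        split_ifs
        exacts [h.1, h.2]
      · intro h
        have h3 := h a ha
        have h4 := h a₁ ha₁
        rw [if_neg ha'] at h3
        rw [if_pos ha₁'] at h4
        exact ⟨h4, h3⟩

/-- The data of a pair of labellings `u`, `v` determining the number of cell maps when one of them
has at most two classes. -/
def cycleData (k : ℕ) (u v : ℕ → ℕ) : ℕ × ℕ × ℕ × ℕ :=
  force (labelCount k u) fun c => force (labelCount k v) fun d =>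
    if c = 2 then (c, d, insideCount k u v, outsideCount k u v) else
    if d = 2 then (c, d, insideCount k v u, outsideCount k v u) else (c, d, 0, 0)

/-- The number of cell maps of a pair of permutations with given data. -/
def dataCount (μ : YoungDiagram) : ℕ × ℕ × ℕ × ℕ → ℕ
  | (c, d, p, q) =>
    if c = 1 then powerSum μ d else
    if d = 1 then powerSum μ.transpose c else
    if c = 2 then pairSum μ p q (d - p - q) else pairSum μ.transpose p q (c - p - q)

theorem labelCount_label_ne_zero {k : ℕ} (σ : Perm (Fin (k + 1))) :
    labelCount (k + 1) (label σ) ≠ 0 :=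
  Finset.card_ne_zero_of_mem (a := 0) (by simp [label_zero])

theorem card_cellMaps_eq_dataCount {k : ℕ} (μ : YoungDiagram) (σ τ : Perm (Fin (k + 1)))
    (h : labelCount (k + 1) (label σ) ≤ 2 ∨ labelCount (k + 1) (label τ) ≤ 2) :
    (cellMaps μ σ τ).card = dataCount μ (cycleData (k + 1) (label σ) (label τ)) := by
  have hσ := labelCount_label_ne_zero σ
  have hτ := labelCount_label_ne_zero τ
  by_cases h1 : labelCount (k + 1) (label σ) = 1
  · rw [card_cellMaps_of_labelCount_eq_one μ h1 τ]
    simp only [cycleData, force_eq]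
    split_ifs <;> simp only [dataCount, if_pos h1]
  by_cases h2 : labelCount (k + 1) (label τ) = 1
  · rw [← card_cellMaps_transpose, card_cellMaps_of_labelCount_eq_one _ h2 σ]
    simp only [cycleData, force_eq]
    split_ifs <;> simp only [dataCount, if_neg h1, if_pos h2]
  by_cases h3 : labelCount (k + 1) (label σ) = 2
  · simp only [cycleData, force_eq, if_pos h3, dataCount, if_neg h1, if_neg h2]
    exact card_cellMaps_of_labelCount_eq_two μ h3 τ
  · have h4 : labelCount (k + 1) (label τ) = 2 := by omega
    simp only [cycleData, force_eq, if_neg h3, if_pos h4, dataCount, if_neg h1, if_neg h2]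
    rw [← card_cellMaps_transpose]
    exact card_cellMaps_of_labelCount_eq_two _ h4 σ

/-- The octal digit of `t` in position `a`. -/
def digit (t a : ℕ) : ℕ := t / 8 ^ a % 8

/-- The number whose octal digits are `f 0, …, f (n - 1)`. -/
def tabulate (f : ℕ → ℕ) : ℕ → ℕ
  | 0 => 0
  | n + 1 => tabulate f n + f n * 8 ^ n

theorem tabulate_lt {f : ℕ → ℕ} {n : ℕ} (hf : ∀ a < n, f a < 8) : tabulate f n < 8 ^ n := by
  induction n with
  | zero => simp [tabulate]
  | succ n ih =>
    have h1 := ih fun a ha => hf a (by omega)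
    have h2 : f n * 8 ^ n ≤ 7 * 8 ^ n := Nat.mul_le_mul_right _ (by have := hf n (by omega); omega)
    rw [tabulate, pow_succ]
    omega

theorem digit_tabulate {f : ℕ → ℕ} {n : ℕ} (hf : ∀ a < n, f a < 8) :
    ∀ a < n, digit (tabulate f n) a = f a := by
  induction n with
  | zero => simp
  | succ n ih =>
    intro a ha
    have hlt := tabulate_lt fun a ha => hf a (Nat.lt_succ_of_lt ha)
    rcases Nat.lt_succ_iff_lt_or_eq.1 ha with h | rfl
    · obtain ⟨m, rfl⟩ : ∃ m, n = a + 1 + m := ⟨n - (a + 1), by omega⟩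
      rw [← ih (fun a ha => hf a (Nat.lt_succ_of_lt ha)) a h, digit, digit, tabulate,
        pow_add, pow_succ, show ∀ x y : ℕ, x * (8 ^ a * 8 * y) = 8 ^ a * (8 * (x * y)) by
          intros; ring, Nat.add_mul_div_left _ _ (by positivity), Nat.add_mul_mod_self_left]
    · rw [digit, tabulate, Nat.add_mul_div_right _ _ (by positivity), Nat.div_eq_of_lt hlt,
        zero_add, Nat.mod_eq_of_lt (hf a ha)]

/-- The digits of the result are the values of `σ`. -/
def permTable {k : ℕ} (σ : Perm (Fin k)) : ℕ := tabulate (toNatFun σ) k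

/-- The digits of the result are the least elements of the cycles of the permutation with
table `t`. -/
def labelTable (k t : ℕ) : ℕ := tabulate (fun a => orbitMin (digit t) k a a) k

theorem digit_labelTable {k : ℕ} (hk : k ≤ 8) (σ : Perm (Fin k)) :
    ∀ a < k, digit (labelTable k (permTable σ)) a = label σ a := by
  have hσ : ∀ a < k, toNatFun σ a < k := fun a ha => by simp [toNatFun, ha]
  have h1 : ∀ a < k, toNatFun σ a = digit (permTable σ) a := fun a ha =>
    (digit_tabulate (fun a ha => (hσ a ha).trans_le hk) a ha).symm
  have h2 : ∀ a < k, orbitMin (digit (permTable σ)) k a a = label σ a := fun a ha =>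
    (orbitMin_congr hσ h1 k a ha a).symm
  intro a ha
  rw [labelTable, digit_tabulate _ a ha, h2 a ha]
  intro b hb
  rw [h2 b hb]
  exact (label_lt σ ⟨b, hb⟩).trans_le hk

theorem labelCount_congr {k : ℕ} {u u' : ℕ → ℕ} (hu : ∀ a < k, u a = u' a) :
    labelCount k u = labelCount k u' := by
  unfold labelCount
  congr 1
  refine Finset.filter_congr fun a ha => ?_
  rw [hu a (Finset.mem_range.1 ha)]

theorem insideCount_congr {k : ℕ} {u u' v v' : ℕ → ℕ} (hu : ∀ a < k, u a = u' a)
    (hv : ∀ a < k, v a = v' a) : insideCount k u v = insideCount k u' v' := by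
  unfold insideCount
  congr 1
  refine Finset.filter_congr fun b hb => ?_
  rw [hv b (Finset.mem_range.1 hb)]
  refine and_congr_right fun _ => forall₂_congr fun a ha => ?_
  rw [hu a ha, hv a ha]

theorem outsideCount_congr {k : ℕ} {u u' v v' : ℕ → ℕ} (hu : ∀ a < k, u a = u' a)
    (hv : ∀ a < k, v a = v' a) : outsideCount k u v = outsideCount k u' v' := by
  unfold outsideCount
  congr 1
  refine Finset.filter_congr fun b hb => ?_
  rw [hv b (Finset.mem_range.1 hb)]
  refine and_congr_right fun _ => forall₂_congr fun a ha => ?_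
  rw [hu a ha, hv a ha]

theorem cycleData_congr {k : ℕ} {u u' v v' : ℕ → ℕ} (hu : ∀ a < k, u a = u' a)
    (hv : ∀ a < k, v a = v' a) : cycleData k u v = cycleData k u' v' := by
  simp only [cycleData, force_eq, labelCount_congr hu, labelCount_congr hv,
    insideCount_congr hu hv, insideCount_congr hv hu, outsideCount_congr hu hv,
    outsideCount_congr hv hu]

/-- The data of the factorization starting with `σ`. -/
def factorData {k : ℕ} (σ : Perm (Fin k)) : ℕ × ℕ × ℕ × ℕ :=
  cycleData k (label σ) (label (cofactor σ))

/-- The data of the factorization starting with `σ`, or zero if `σ` contributes to the part of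
degree `d`; this is computed from tables. -/
def lowerData {k : ℕ} (d : ℕ) (σ : Perm (Fin k)) : ℕ × ℕ × ℕ × ℕ :=
  force (permTable σ) fun s => force (permTable (cofactor σ)) fun t =>
    force (labelTable k s) fun u => force (labelTable k t) fun v =>
      if labelCount k (digit u) + labelCount k (digit v) = d then (0, 0, 0, 0) else
        cycleData k (digit u) (digit v)

theorem lowerData_eq {k : ℕ} (hk : k ≤ 8) (d : ℕ) (σ : Perm (Fin k)) :
    lowerData d σ = if totalCycles σ = d then (0, 0, 0, 0) else factorData σ := by
  have hu := digit_labelTable hk σ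
  have hv := digit_labelTable hk (cofactor σ)
  simp only [lowerData, force_eq, labelCount_congr hu, labelCount_congr hv, cycleData_congr hu hv,
    totalCycles, factorData]
  split_ifs with h <;> simp [h]

theorem factorData_fst {k : ℕ} (σ : Perm (Fin k)) :
    (factorData σ).1 = labelCount k (label σ) := by
  simp only [factorData, cycleData, force_eq]
  split_ifs <;> rfl

theorem factorData_snd_fst {k : ℕ} (σ : Perm (Fin k)) :
    (factorData σ).2.1 = labelCount k (label (cofactor σ)) := by
  simp only [factorData, cycleData, force_eq]
  split_ifs <;> rfl

/-- The contribution to degree `d` of a factorization in terms of its data. -/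
def dataTerm (μ : YoungDiagram) (k d : ℕ) (x : ℕ × ℕ × ℕ × ℕ) : ℚ :=
  if x.1 + x.2.1 = d then (-1) ^ (k + x.2.1) * dataCount μ x else 0

theorem ite_stanleyTerm_eq_dataTerm (μ : YoungDiagram) {k : ℕ}
    (hsign : ∀ σ : Perm (Fin (k + 1)), Perm.sign σ = (-1) ^ (k + 1 + labelCount (k + 1) (label σ)))
    {d : ℕ} (hd : d ≤ 5) (σ : Perm (Fin (k + 1))) :
    (if totalCycles σ = d then stanleyTerm μ σ else 0) = dataTerm μ (k + 1) d (factorData σ) := by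
  rw [dataTerm, factorData_fst, factorData_snd_fst, totalCycles]
  split_ifs with h
  · rw [stanleyTerm, hsign, card_cellMaps_eq_dataCount μ σ _ (by omega), factorData]
    push_cast
    rfl
  · rfl

theorem gradedSigma_eq_sum_map (μ : YoungDiagram) {k : ℕ}
    (hsign : ∀ σ : Perm (Fin (k + 1)), Perm.sign σ = (-1) ^ (k + 1 + labelCount (k + 1) (label σ)))
    {d : ℕ} (hd : d ≤ 5) : gradedSigma μ (k + 1) d =
      (((Finset.univ : Finset (Perm (Fin (k + 1)))).val.map factorData).map
        (dataTerm μ (k + 1) d)).sum := by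
  rw [gradedSigma, Multiset.map_map]
  exact Finset.sum_congr rfl fun σ _ => ite_stanleyTerm_eq_dataTerm μ hsign hd σ

theorem gradedSigma_eq_sum_map_lowerData (μ : YoungDiagram) {k : ℕ} (hk : k + 1 ≤ 8)
    (hsign : ∀ σ : Perm (Fin (k + 1)), Perm.sign σ = (-1) ^ (k + 1 + labelCount (k + 1) (label σ)))
    {d e : ℕ} (hd0 : d ≠ 0) (hd : d ≤ 5) (hde : d ≠ e) : gradedSigma μ (k + 1) d =
      (((Finset.univ : Finset (Perm (Fin (k + 1)))).val.map (lowerData e)).map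
        (dataTerm μ (k + 1) d)).sum := by
  rw [gradedSigma, Multiset.map_map]
  refine Finset.sum_congr rfl fun σ _ => ?_
  rw [ite_stanleyTerm_eq_dataTerm μ hsign hd σ, Function.comp_apply, lowerData_eq hk]
  split_ifs with h
  · rw [dataTerm, factorData_fst, factorData_snd_fst, if_neg, dataTerm, if_neg]
    · simpa using hd0.symm
    · intro h'
      exact hde (h'.symm.trans h)
  · rfl

theorem sign_perm_one (σ : Perm (Fin 1)) :
    Perm.sign σ = (-1) ^ (1 + labelCount 1 (label σ)) := by
  revert σ; decide +kernel

theorem sign_perm_two (σ : Perm (Fin 2)) :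
    Perm.sign σ = (-1) ^ (2 + labelCount 2 (label σ)) := by
  revert σ; decide +kernel

theorem sign_perm_four (σ : Perm (Fin 4)) :
    Perm.sign σ = (-1) ^ (4 + labelCount 4 (label σ)) := by
  revert σ; decide +kernel

theorem map_factorData_one :
    (Finset.univ : Finset (Perm (Fin 1))).val.map factorData = {(1, 1, 0, 0)} := by
  decide +kernel

theorem map_factorData_two : (Finset.univ : Finset (Perm (Fin 2))).val.map factorData =
    {(1, 2, 0, 0)} + {(2, 1, 0, 0)} := by
  decide +kernel

theorem map_lowerData_four : (Finset.univ : Finset (Perm (Fin 4))).val.map (lowerData 3) =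
    Multiset.replicate 10 (0, 0, 0, 0) + {(1, 4, 0, 0)} + {(4, 1, 0, 0)} +
    {(2, 3, 0, 2)} + Multiset.replicate 3 (2, 3, 2, 0) + Multiset.replicate 2 (2, 3, 1, 1) +
    {(3, 2, 0, 2)} + Multiset.replicate 3 (3, 2, 2, 0) + Multiset.replicate 2 (3, 2, 1, 1) := by
  decide +kernel

theorem sign_perm_six (σ : Perm (Fin 6)) :
    Perm.sign σ = (-1) ^ (6 + labelCount 6 (label σ)) := by
  have h : ∀ σ : Perm (Fin 6), Perm.sign σ = (-1) ^ (6 + force (permTable σ) fun s =>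
      force (labelTable 6 s) fun u => labelCount 6 (digit u)) := by
    decide +kernel
  rw [h, force_eq, force_eq, labelCount_congr (digit_labelTable (by norm_num) σ)]

theorem map_lowerData_six : (Finset.univ : Finset (Perm (Fin 6))).val.map (lowerData 7) =
    Multiset.replicate 132 (0, 0, 0, 0) + (Multiset.replicate 84 (1, 2, 0, 0) +
    (Multiset.replicate 84 (2, 1, 0, 0) + (Multiset.replicate 35 (1, 4, 0, 0) +
    (Multiset.replicate 35 (4, 1, 0, 0) + (Multiset.replicate 1 (2, 3, 0, 0) +
    (Multiset.replicate 13 (2, 3, 0, 1) + (Multiset.replicate 20 (2, 3, 1, 0) +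
    (Multiset.replicate 21 (2, 3, 0, 2) + (Multiset.replicate 84 (2, 3, 2, 0) +
    (Multiset.replicate 36 (2, 3, 1, 1) + (Multiset.replicate 1 (3, 2, 0, 0) +
    (Multiset.replicate 13 (3, 2, 0, 1) + (Multiset.replicate 20 (3, 2, 1, 0) +
    (Multiset.replicate 21 (3, 2, 0, 2) + (Multiset.replicate 84 (3, 2, 2, 0) +
    Multiset.replicate 36 (3, 2, 1, 1)))))))))))))))) := by
  decide +kernel

theorem sum_sum_eq_of_symm (s : Finset ℕ) (f g : ℕ → ℕ → ℕ)
    (h : ∀ i j, f i j + f j i = g i j + g j i) :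
    ∑ i ∈ s, ∑ j ∈ s, f i j = ∑ i ∈ s, ∑ j ∈ s, g i j := by
  have key : ∀ f : ℕ → ℕ → ℕ,
      ∑ i ∈ s, ∑ j ∈ s, (f i j + f j i) = 2 * ∑ i ∈ s, ∑ j ∈ s, f i j := by
    intro f
    simp only [Finset.sum_add_distrib]
    rw [Finset.sum_comm (f := fun i j => f j i), two_mul]
  have := key f
  simp only [h, key g] at this
  omega

theorem pairSum_comm (μ : YoungDiagram) (p q r : ℕ) : pairSum μ p q r = pairSum μ q p r := by
  rw [pairSum, Finset.sum_comm]
  refine Finset.sum_congr rfl fun i _ => Finset.sum_congr rfl fun j _ => ?_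
  rw [min_comm, mul_comm (_ ^ p)]

theorem powerSum_two_mul_powerSum_one (μ : YoungDiagram) :
    pairSum μ 0 0 3 + 33 * pairSum μ 1 0 2 + 35 * (powerSum μ 2 * powerSum μ 1) =
      35 * pairSum μ 2 0 1 + 34 * pairSum μ 1 1 1 := by
  simp only [pairSum, powerSum, Finset.sum_mul_sum]
  simp only [Finset.mul_sum, ← Finset.sum_add_distrib]
  apply sum_sum_eq_of_symm
  intro i j
  rcases le_total (μ.rowLen i) (μ.rowLen j) with h | h
  · rw [min_comm (μ.rowLen j), min_eq_left h]; ring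
  · rw [min_comm (μ.rowLen j), min_eq_right h]; ring

theorem powerSum_transpose_one (μ : YoungDiagram) : powerSum μ.transpose 1 = powerSum μ 1 := by
  have h : labelCount 1 (label (1 : Perm (Fin 1))) = 1 := by decide +kernel
  have h1 := card_cellMaps_of_labelCount_eq_one μ h 1
  have h2 := card_cellMaps_of_labelCount_eq_one μ.transpose h 1
  rw [h] at h1 h2
  rw [← h1, ← h2, card_cellMaps_transpose]

theorem gradedSigma_one_two (μ : YoungDiagram) : gradedSigma μ 1 2 = powerSum μ 1 := by
  rw [gradedSigma_eq_sum_map μ sign_perm_one (by norm_num), map_factorData_one]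
  simp [dataTerm, dataCount]

theorem gradedSigma_two_three (μ : YoungDiagram) :
    gradedSigma μ 2 3 = powerSum μ 2 - powerSum μ.transpose 2 := by
  rw [gradedSigma_eq_sum_map μ sign_perm_two (by norm_num), map_factorData_two]
  simp [dataTerm, dataCount]
  ring

theorem gradedSigma_four_five (μ : YoungDiagram) : gradedSigma μ 4 5 =
    powerSum μ 4 - powerSum μ.transpose 4 -
      (pairSum μ 0 2 1 + 3 * pairSum μ 2 0 1 + 2 * pairSum μ 1 1 1) +
      (pairSum μ.transpose 0 2 1 + 3 * pairSum μ.transpose 2 0 1 +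
        2 * pairSum μ.transpose 1 1 1) := by
  rw [gradedSigma_eq_sum_map_lowerData μ (by norm_num) sign_perm_four (e := 3) (by norm_num)
    (by norm_num) (by norm_num), map_lowerData_four]
  simp [dataTerm, dataCount]
  ring

theorem gradedSigma_six_three (μ : YoungDiagram) :
    gradedSigma μ 6 3 = 84 * (powerSum μ 2 - powerSum μ.transpose 2) := by
  rw [gradedSigma_eq_sum_map_lowerData μ (by norm_num) sign_perm_six (e := 7) (by norm_num)
    (by norm_num) (by norm_num), map_lowerData_six]
  simp only [Multiset.map_add, Multiset.sum_add, Multiset.map_replicate, Multiset.sum_replicate,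
    nsmul_eq_mul]
  norm_num [dataTerm, dataCount]
  ring

theorem gradedSigma_six_five (μ : YoungDiagram) : gradedSigma μ 6 5 =
    35 * (powerSum μ 4 - powerSum μ.transpose 4) -
      (pairSum μ 0 0 3 + 13 * pairSum μ 0 1 2 + 20 * pairSum μ 1 0 2 + 21 * pairSum μ 0 2 1 +
        84 * pairSum μ 2 0 1 + 36 * pairSum μ 1 1 1) +
      (pairSum μ.transpose 0 0 3 + 13 * pairSum μ.transpose 0 1 2 +
        20 * pairSum μ.transpose 1 0 2 + 21 * pairSum μ.transpose 0 2 1 +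
        84 * pairSum μ.transpose 2 0 1 + 36 * pairSum μ.transpose 1 1 1) := by
  rw [gradedSigma_eq_sum_map_lowerData μ (by norm_num) sign_perm_six (e := 7) (by norm_num)
    (by norm_num) (by norm_num), map_lowerData_six]
  simp only [Multiset.map_add, Multiset.sum_add, Multiset.map_replicate, Multiset.sum_replicate,
    nsmul_eq_mul]
  norm_num [dataTerm, dataCount]
  ring

theorem totalCycles_six (σ : Perm (Fin 6)) :
    totalCycles σ = 3 ∨ totalCycles σ = 5 ∨ totalCycles σ = 7 := by
  by_cases h : totalCycles σ = 7
  · exact Or.inr (Or.inr h)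
  have hmem : lowerData 7 σ ∈ (Finset.univ : Finset (Perm (Fin 6))).val.map (lowerData 7) :=
    Multiset.mem_map_of_mem _ (Finset.mem_univ σ)
  rw [map_lowerData_six, lowerData_eq (by norm_num), if_neg h] at hmem
  have htot : totalCycles σ = (factorData σ).1 + (factorData σ).2.1 := by
    rw [factorData_fst, factorData_snd_fst, totalCycles]
  have hne : (factorData σ).1 ≠ 0 := by
    rw [factorData_fst]
    exact labelCount_label_ne_zero σ
  rw [htot]
  simp only [Multiset.mem_add, Multiset.mem_replicate] at hmem
  rcases hmem with h | h | h | h | h | h | h | h | h | h | h | h | h | h | h | h | h <;>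
    simp [h.2] at hne ⊢

theorem SigmaCycle_six (μ : YoungDiagram) :
    SigmaCycle μ 6 = gradedSigma μ 6 3 + gradedSigma μ 6 5 + gradedSigma μ 6 7 := by
  rw [SigmaCycle_eq_sum, gradedSigma, gradedSigma, gradedSigma, ← Finset.sum_add_distrib,
    ← Finset.sum_add_distrib]
  refine Finset.sum_congr rfl fun σ _ => ?_
  rcases totalCycles_six σ with h | h | h <;> simp [h]

end

/-- For every Young diagram `μ`, `Σ_6^μ = R_7^μ + 35·R_5^μ + 35·R_3^μ·R_2^μ + 84·R_3^μ`
(the Kerov polynomial `K_6` is `R_7 + 35R_5 + 35R_3R_2 + 84R_3`). -/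
theorem kerov_K6 (μ : YoungDiagram) :
    SigmaCycle μ 6 = freeCumulant μ 7 + 35 * freeCumulant μ 5
      + 35 * freeCumulant μ 3 * freeCumulant μ 2 + 84 * freeCumulant μ 3 := by
  rw [SigmaCycle_six, freeCumulant_succ μ 6, freeCumulant_succ μ 4, freeCumulant_succ μ 2,
    freeCumulant_succ μ 1, gradedSigma_one_two, gradedSigma_two_three, gradedSigma_four_five,
    gradedSigma_six_three, gradedSigma_six_five]
  have h1 : (_ : ℚ) = _ := congrArg Nat.cast (powerSum_two_mul_powerSum_one μ)
  have h2 : (_ : ℚ) = _ := congrArg Nat.cast (powerSum_two_mul_powerSum_one μ.transpose)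
  rw [powerSum_transpose_one] at h2
  push_cast at h1 h2
  rw [pairSum_comm μ 0 1, pairSum_comm μ 0 2, pairSum_comm μ.transpose 0 1,
    pairSum_comm μ.transpose 0 2]
  linear_combination h2 - h1

end AsympRep
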